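/- Assume the generality assumption, and suppose Γ = Z_A ∩ Z_B is finite. If Γ consists of at least 7 distinct points, then four points of Γ lie on a common line both in P(V_A) and in P(V_B). -/

import Mathlib

/-!
Common setup (k algebraically closed, `V = k⁵`, matrices `A₁` (2×4) and `B₁` (3×2) with
entries in `V`):

* A dual vector is represented by `φ : Fin 5 → k`, acting on `v : V` by `Σ l, φ l * v l`;
  `rankOneLocus A` is the (affine cone, minus 0, over the) locus in `P(V*)` where the
  matrix `A` has rank 1.
* `C_A` is a smooth rational normal quartic curve iff its cone is the image of the cone over
  the standard quartic `(s:t) ↦ (s⁴, s³t, s²t², st³, t⁴)` under a linear automorphism;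
  similarly `S_B` is a (smooth) rational cubic surface scroll iff its cone is the image of
  the cone over the standard scroll `S(1,2)`, `(a,b;s:t) ↦ (as, at, bs², bst, bt²)`.
  (Over an algebraically closed field the parametrized sets are the full affine cones.)
* `V_A` is the span of the 4 columns of `A₁` in `V ⊕ V`, `V_B` the span of the 3 rows of
  `B₁`; the double (Veronese) embeddings into `P(⋀²V)` have as affine cones the sets
  `coneZ V_A`, `coneZ V_B` of wedges `v₁ ∧ v₂` with `(v₁,v₂)` in `V_A` resp. `V_B`
  (computed in the exterior algebra).  `gammaSet` is the set `Z_A ∩ Z_B` of common points,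
  a subset of the projectivization of the exterior algebra.
-/

open ExteriorAlgebra

/-- The affine cone over the standard rational normal quartic curve. -/
def coneQuartic (k : Type*) [Field k] : Set (Fin 5 → k) :=
  {w | ∃ s t : k, w = ![s ^ 4, s ^ 3 * t, s ^ 2 * t ^ 2, s * t ^ 3, t ^ 4]}

/-- The affine cone over the standard smooth rational cubic surface scroll `S(1,2)`. -/
def coneScroll (k : Type*) [Field k] : Set (Fin 5 → k) :=
  {w | ∃ a b s t : k, w = ![a * s, a * t, b * s ^ 2, b * s * t, b * t ^ 2]}

/-- The rank-one locus in `P(V*)` (as an affine cone minus the origin) of a matrix with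
entries in `V = k⁵`. -/
def rankOneLocus {k : Type*} [Field k] {m n : ℕ}
    (A : Matrix (Fin m) (Fin n) (Fin 5 → k)) : Set (Fin 5 → k) :=
  {φ | (Matrix.of fun i j => ∑ l, φ l * A i j l).rank = 1}

/-- `C_A` is a smooth rational normal quartic curve. -/
def IsRNQuartic {k : Type*} [Field k] {m n : ℕ}
    (A : Matrix (Fin m) (Fin n) (Fin 5 → k)) : Prop :=
  ∃ g : (Fin 5 → k) ≃ₗ[k] (Fin 5 → k), rankOneLocus A ∪ {0} = g '' coneQuartic k

/-- `S_B` is a smooth rational cubic surface scroll. -/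
def IsCubicScroll {k : Type*} [Field k] {m n : ℕ}
    (B : Matrix (Fin m) (Fin n) (Fin 5 → k)) : Prop :=
  ∃ g : (Fin 5 → k) ≃ₗ[k] (Fin 5 → k), rankOneLocus B ∪ {0} = g '' coneScroll k

/-- The span of the columns of `A₁` in `V ⊕ V`. -/
def colSpace {k : Type*} [Field k]
    (A₁ : Matrix (Fin 2) (Fin 4) (Fin 5 → k)) : Submodule k ((Fin 5 → k) × (Fin 5 → k)) :=
  Submodule.span k (Set.range fun j => (A₁ 0 j, A₁ 1 j))

/-- The span of the rows of `B₁` in `V ⊕ V`. -/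
def rowSpace {k : Type*} [Field k]
    (B₁ : Matrix (Fin 3) (Fin 2) (Fin 5 → k)) : Submodule k ((Fin 5 → k) × (Fin 5 → k)) :=
  Submodule.span k (Set.range fun i => (B₁ i 0, B₁ i 1))

/-- The affine cone (inside the exterior algebra) over the image `Z_W ⊆ P(⋀²V)` of `P(W)`
under the double (quadratic Veronese) embedding `(v₁,v₂) ↦ v₁ ∧ v₂`. -/
def coneZ {k : Type*} [Field k] (W : Submodule k ((Fin 5 → k) × (Fin 5 → k))) :
    Set (ExteriorAlgebra k (Fin 5 → k)) :=
  {ω | ∃ p ∈ W, ω = ι k p.1 * ι k p.2}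

/-- The set `Γ = Z_A ∩ Z_B` of common points, inside the projectivization. -/
def gammaSet {k : Type*} [Field k]
    (A₁ : Matrix (Fin 2) (Fin 4) (Fin 5 → k)) (B₁ : Matrix (Fin 3) (Fin 2) (Fin 5 → k)) :
    Set (Projectivization k (ExteriorAlgebra k (Fin 5 → k))) :=
  {z | ∃ (ω : ExteriorAlgebra k (Fin 5 → k)) (hω : ω ≠ 0),
    z = Projectivization.mk k ω hω ∧ ω ∈ coneZ (colSpace A₁) ∩ coneZ (rowSpace B₁)}


section PartOne
variable {k : Type*} [Field k]

/-- The five Plücker relations, written in terms of the symmetric matrix `h`. -/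
def PlRel (h : Fin 4 → Fin 4 → k) : Prop :=
  h 0 0 * (h 2 2 - h 1 3) - h 0 1 * (h 1 2 - h 0 3) + h 0 2 * (h 1 1 - h 0 2) = 0 ∧
  h 0 0 * h 2 3 - h 0 1 * h 1 3 + h 0 3 * (h 1 1 - h 0 2) = 0 ∧
  h 0 0 * h 3 3 - h 0 2 * h 1 3 + h 0 3 * (h 1 2 - h 0 3) = 0 ∧
  h 0 1 * h 3 3 - h 0 2 * h 2 3 + h 0 3 * (h 2 2 - h 1 3) = 0 ∧
  (h 1 1 - h 0 2) * h 3 3 - (h 1 2 - h 0 3) * h 2 3 + h 1 3 * (h 2 2 - h 1 3) = 0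

def GoodP (P : Fin 4 → k) : Prop :=
  ∃ Q : Fin 4 → k, (∀ r s : k, (∀ i, r * P i + s * Q i = 0) → r = 0 ∧ s = 0) ∧
    ∀ h : Fin 4 → Fin 4 → k, (∀ i j, h i j = h j i) → PlRel h →
      (∀ j, ∑ i, P i * h i j = 0) →
      (∀ j, ∑ i, Q i * h i j = 0) ∨ ∃ f : Fin 4 → k, ∀ i j, h i j = f i * f j

theorem rk1_3 [IsAlgClosed k] (a b c d e g : k) (X11 : d * g - e * e = 0)
    (X12 : c * e - b * g = 0) (X13 : b * e - c * d = 0) (X22 : a * g - c * c = 0)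
    (X23 : b * c - a * e = 0) (X33 : a * d - b * b = 0) :
    ∃ x y z : k, a = x * x ∧ b = x * y ∧ c = x * z ∧ d = y * y ∧ e = y * z ∧ g = z * z := by
  by_cases ha : a = 0
  · subst ha
    have hb : b = 0 := by
      have : b * b = 0 := by linear_combination -X33
      simpa using this
    have hc : c = 0 := by
      have : c * c = 0 := by linear_combination -X22
      simpa using this
    subst hb hc
    by_cases hd : d = 0
    · subst hd
      have he : e = 0 := by
        have : e * e = 0 := by linear_combination -X11
        simpa using this
      subst he
      obtain ⟨z, hz⟩ := IsAlgClosed.exists_pow_nat_eq g (n := 2) (by norm_num)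
      exact ⟨0, 0, z, by simp, by simp, by simp, by simp, by simp, by rw [← hz]; ring⟩
    · obtain ⟨y, hy⟩ := IsAlgClosed.exists_pow_nat_eq d (n := 2) (by norm_num)
      have hy0 : y ≠ 0 := by rintro rfl; apply hd; rw [← hy]; simp
      refine ⟨0, y, e / y, by simp, by simp, by simp, by rw [← hy]; ring, by field_simp, ?_⟩
      field_simp
      linear_combination X11 + g * hy
  · obtain ⟨x, hx⟩ := IsAlgClosed.exists_pow_nat_eq a (n := 2) (by norm_num)
    have hx0 : x ≠ 0 := by rintro rfl; apply ha; rw [← hx]; simp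
    refine ⟨x, b / x, c / x, by rw [← hx]; ring, by field_simp, by field_simp, ?_, ?_, ?_⟩
    · field_simp
      linear_combination X33 + d * hx
    · field_simp
      linear_combination - X23 + e * hx
    · field_simp
      linear_combination X22 + g * hx

theorem adj_case [IsAlgClosed k] (a b c d e g n1 n2 n3 q : k) (hn : n1 = 1 ∨ n3 = 1)
    (X11 : d * g - e * e = q * n1 * n1)
    (X12 : c * e - b * g = q * n1 * n2) (X13 : b * e - c * d = q * n1 * n3)
    (X22 : a * g - c * c = q * n2 * n2)
    (X23 : b * c - a * e = q * n2 * n3) (X33 : a * d - b * b = q * n3 * n3) :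
    (n1 * a + n2 * b + n3 * c = 0 ∧ n1 * b + n2 * d + n3 * e = 0 ∧
      n1 * c + n2 * e + n3 * g = 0) ∨
    ∃ x y z : k, a = x * x ∧ b = x * y ∧ c = x * z ∧ d = y * y ∧ e = y * z ∧ g = z * z := by
  by_cases hq : q = 0
  · right
    subst hq
    exact rk1_3 a b c d e g (by simpa using X11) (by simpa using X12) (by simpa using X13)
      (by simpa using X22) (by simpa using X23) (by simpa using X33)
  · left
    rcases hn with rfl | rfl
    · have h2 : q * (1 * b + n2 * d + n3 * e) = 0 := by
        linear_combination (-b) * X11 - d * X12 - e * X13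
      have h3 : q * (1 * c + n2 * e + n3 * g) = 0 := by
        linear_combination (-c) * X11 - e * X12 - g * X13
      have h2' := (mul_eq_zero.1 h2).resolve_left hq
      have h3' := (mul_eq_zero.1 h3).resolve_left hq
      have h1 : q * (1 * a + n2 * b + n3 * c) = 0 := by
        linear_combination (-a) * X11 - b * X12 - c * X13 + b * X12 + d * X22 + e * X23
          + q * n2 * h2'
      exact ⟨(mul_eq_zero.1 h1).resolve_left hq, h2', h3'⟩
    · have h1 : q * (n1 * a + n2 * b + 1 * c) = 0 := by
        linear_combination (-a) * X13 - b * X23 - c * X33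
      have h2 : q * (n1 * b + n2 * d + 1 * e) = 0 := by
        linear_combination (-b) * X13 - d * X23 - e * X33
      have h1' := (mul_eq_zero.1 h1).resolve_left hq
      have h2' := (mul_eq_zero.1 h2).resolve_left hq
      have h3 : q * (n1 * c + n2 * e + 1 * g) = 0 := by
        linear_combination (-c) * X13 - e * X23 - g * X33 + b * X12 + d * X22 + e * X23
          + q * n2 * h2'
      exact ⟨h1', h2', (mul_eq_zero.1 h3).resolve_left hq⟩

theorem goodP_smul (P : Fin 4 → k) (r : k) (hr : r ≠ 0) (h : GoodP (fun i => r * P i)) :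
    GoodP P := by
  obtain ⟨Q, h1, h2⟩ := h
  refine ⟨Q, fun a b hab => ?_, fun h hs hp hP => h2 h hs hp fun j => ?_⟩
  · have := h1 (a / r) b (fun i => by rw [← hab i]; field_simp)
    refine ⟨?_, this.2⟩
    have h3 := this.1
    rw [div_eq_zero_iff] at h3
    exact h3.resolve_right hr
  · simp only [mul_assoc, ← Finset.mul_sum, hP j, mul_zero]

theorem goodP_rev (P : Fin 4 → k) (h : GoodP (fun i => P (Fin.rev i))) : GoodP P := by
  obtain ⟨Q, h1, h2⟩ := h
  refine ⟨fun i => Q (Fin.rev i), fun a b hab => h1 a b fun i => by simpa using hab (Fin.rev i),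
    fun h hs hp hP => ?_⟩
  have key := h2 (fun i j => h (Fin.rev i) (Fin.rev j)) (fun i j => hs _ _) ?_ ?_
  · rcases key with key | ⟨f, hf⟩
    · left
      intro j
      rw [← key (Fin.rev j), ← Equiv.sum_comp Fin.revPerm]
      simp
    · right
      exact ⟨fun i => f (Fin.rev i), fun i j => by rw [← hf]; simp⟩
  · obtain ⟨p1, p2, p3, p4, p5⟩ := hp
    have r0 : Fin.rev (0 : Fin 4) = 3 := rfl
    have r1 : Fin.rev (1 : Fin 4) = 2 := rfl
    have r2 : Fin.rev (2 : Fin 4) = 1 := rfl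
    have r3 : Fin.rev (3 : Fin 4) = 0 := rfl
    simp only [PlRel, r0, r1, r2, r3, hs 3 2, hs 3 1, hs 3 0, hs 2 1, hs 2 0, hs 1 0]
    refine ⟨?_, ?_, ?_, ?_, ?_⟩
    · linear_combination p5
    · linear_combination p4
    · linear_combination p3
    · linear_combination p2
    · linear_combination p1
  · intro j
    rw [← hP (Fin.rev j), ← Equiv.sum_comp Fin.revPerm]
    simp


theorem scal (x y z a b f d e g h00 h01 h02 h03 : k)
    (P0 : h00 + x * h01 + y * h02 + z * h03 = 0)
    (P1 : h01 + x * a + y * b + z * f = 0)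
    (P2 : h02 + x * b + y * d + z * e = 0)
    (P3 : h03 + x * f + y * e + z * g = 0)
    (p1 : h00 * (d - f) - h01 * (b - h03) + h02 * (a - h02) = 0)
    (p2 : h00 * e - h01 * f + h03 * (a - h02) = 0)
    (p3 : h00 * g - h02 * f + h03 * (b - h03) = 0)
    (p4 : h01 * g - h02 * e + h03 * (d - f) = 0)
    (p5 : (a - h02) * g - (b - h03) * e + f * (d - f) = 0)
    (X11 X12 X13 X22 X23 X33 : k)
    (e11 : X11 = d * g - e * e) (e12 : X12 = f * e - b * g) (e13 : X13 = b * e - f * d)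
    (e22 : X22 = a * g - f * f) (e23 : X23 = b * f - a * e) (e33 : X33 = a * d - b * b) :
    (X22 - x * X12 + y * X11 - X13 = 0) ∧ ((y - x ^ 2) * X22 = (z - x * y) * X12) ∧
    ((y - x ^ 2) * X12 = (z - x * y) * X11) ∧
    ((y - x ^ 2) * X23 + x * y * X13 + x * z * X12 - y * z * X11 - z * X22 = 0) ∧
    ((x ^ 2 - y) * X33 - 2 * x * z * X13 + z ^ 2 * X11 - x * y * X23 + y ^ 2 * X13
      + x * z * X22 - y * z * X12 + z * X23 = 0) := by
  have P1' : h01 = -(x * a + y * b + z * f) := by linear_combination P1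
  have P2' : h02 = -(x * b + y * d + z * e) := by linear_combination P2
  have P3' : h03 = -(x * f + y * e + z * g) := by linear_combination P3
  have P0' : h00 = -(x * h01 + y * h02 + z * h03) := by linear_combination P0
  subst P0' P1' P2' P3' e11 e12 e13 e22 e23 e33
  refine ⟨?_, ?_, ?_, ?_, ?_⟩
  · linear_combination p5
  · linear_combination y * p5 - p3
  · linear_combination x * p5 + p4
  · linear_combination p2
  · linear_combination p1

theorem extend4 (p1 p2 p3 : k) (h : Fin 4 → Fin 4 → k) (hs : ∀ i j, h i j = h j i)
    (hP : ∀ j, h 0 j + p1 * h 1 j + p2 * h 2 j + p3 * h 3 j = 0)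
    (hx : ∃ x y z : k, h 1 1 = x * x ∧ h 1 2 = x * y ∧ h 1 3 = x * z ∧ h 2 2 = y * y ∧
      h 2 3 = y * z ∧ h 3 3 = z * z) :
    ∃ f : Fin 4 → k, ∀ i j, h i j = f i * f j := by
  obtain ⟨x, y, z, h1, h2, h3, h4, h5, h6⟩ := hx
  have P0 := hP 0
  have P1 := hP 1
  have P2 := hP 2
  have P3 := hP 3
  have s1 := hs 1 0
  have s2 := hs 2 0
  have s3 := hs 3 0
  have s4 := hs 2 1
  have s5 := hs 3 1
  have s6 := hs 3 2
  have k1 : h 0 1 = -(p1 * x + p2 * y + p3 * z) * x := by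
    rw [s4, s5, h1, h2, h3] at P1
    linear_combination P1
  have k2 : h 0 2 = -(p1 * x + p2 * y + p3 * z) * y := by
    rw [s6, h2, h4, h5] at P2
    linear_combination P2
  have k3 : h 0 3 = -(p1 * x + p2 * y + p3 * z) * z := by
    rw [h3, h5, h6] at P3
    linear_combination P3
  have k0 : h 0 0 = -(p1 * x + p2 * y + p3 * z) * -(p1 * x + p2 * y + p3 * z) := by
    rw [s1, s2, s3, k1, k2, k3] at P0
    linear_combination P0
  refine ⟨![-(p1 * x + p2 * y + p3 * z), x, y, z], fun i j => ?_⟩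
  fin_cases i <;> fin_cases j <;> simp <;> grind

theorem goodP_0 [IsAlgClosed k] (x y z : k) (hc : y - x ^ 2 ≠ 0 ∨ z - x * y ≠ 0) :
    GoodP ![1, x, y, z] := by
  have main : ∃ n1 n2 n3 : k, (n1 = 1 ∨ n3 = 1) ∧ ∀ X11 X12 X13 X22 X23 X33 : k,
    (X22 - x * X12 + y * X11 - X13 = 0) → ((y - x ^ 2) * X22 = (z - x * y) * X12) →
    ((y - x ^ 2) * X12 = (z - x * y) * X11) →
    ((y - x ^ 2) * X23 + x * y * X13 + x * z * X12 - y * z * X11 - z * X22 = 0) →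
    ((x ^ 2 - y) * X33 - 2 * x * z * X13 + z ^ 2 * X11 - x * y * X23 + y ^ 2 * X13
      + x * z * X22 - y * z * X12 + z * X23 = 0) →
    ∃ q, X11 = q * n1 * n1 ∧ X12 = q * n1 * n2 ∧ X13 = q * n1 * n3 ∧ X22 = q * n2 * n2 ∧
      X23 = q * n2 * n3 ∧ X33 = q * n3 * n3 := by
    by_cases h : y - x ^ 2 = 0
    · have hz : z - x * y ≠ 0 := by tauto
      refine ⟨0, 0, 1, Or.inr rfl, fun X11 X12 X13 X22 X23 X33 E1 E2 E3 E4 E5 => ?_⟩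
      have hy : y = x ^ 2 := by linear_combination h
      have a1 : X11 = 0 := by
        have : (z - x * y) * X11 = 0 := by linear_combination -E3 + X12 * h
        exact (mul_eq_zero.1 this).resolve_left hz
      have a2 : X12 = 0 := by
        have : (z - x * y) * X12 = 0 := by linear_combination -E2 + X22 * h
        exact (mul_eq_zero.1 this).resolve_left hz
      subst a1 a2
      have a3 : X13 = X22 := by linear_combination -E1
      subst a3
      have a4 : X13 = 0 := by
        have : (z - x * y) * X13 = 0 := by linear_combination -E4 + X23 * h
        exact (mul_eq_zero.1 this).resolve_left hz
      subst a4
      have a5 : X23 = 0 := by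
        have : (z - x * y) * X23 = 0 := by linear_combination E5 + X33 * h
        exact (mul_eq_zero.1 this).resolve_left hz
      subst a5
      exact ⟨X33, by simp⟩
    · obtain ⟨r, hr⟩ : ∃ r, z = x * y + r * (y - x ^ 2) := ⟨(z - x * y) / (y - x ^ 2), by
        field_simp; ring⟩
      refine ⟨1, r, r ^ 2 - x * r + y, Or.inl rfl,
        fun X11 X12 X13 X22 X23 X33 E1 E2 E3 E4 E5 => ⟨X11, by ring, ?_⟩⟩
      subst hr
      have a1 : X12 = X11 * r := by
        apply mul_left_cancel₀ h
        linear_combination E3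
      have a2 : X22 = X11 * r * r := by
        apply mul_left_cancel₀ h
        rw [a1] at E2
        linear_combination E2
      have a3 : X13 = X11 * (r ^ 2 - x * r + y) := by
        rw [a1, a2] at E1
        linear_combination -E1
      subst a1 a2 a3
      have a4 : X23 = X11 * r * (r ^ 2 - x * r + y) := by
        apply mul_left_cancel₀ h
        linear_combination E4
      subst a4
      have a5 : X33 = X11 * (r ^ 2 - x * r + y) * (r ^ 2 - x * r + y) := by
        apply mul_left_cancel₀ h
        linear_combination -E5
      subst a5
      refine ⟨by ring, by ring, by ring, by ring, by ring⟩
  obtain ⟨n1, n2, n3, hn, main⟩ := main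
  refine ⟨![0, n1, n2, n3], ?_, ?_⟩
  · intro a b hab
    have h0 := hab 0
    have h1 := hab 1
    have h3 := hab 3
    simp at h0 h1 h3
    subst h0
    rcases hn with rfl | rfl
    · simpa using h1
    · simpa using h3
  · intro h hs hp hP
    have hP' : ∀ j, h 0 j + x * h 1 j + y * h 2 j + z * h 3 j = 0 := fun j => by
      rw [← hP j]; simp [Fin.sum_univ_four]
    have P0 := hP' 0
    have P1 := hP' 1
    have P2 := hP' 2
    have P3 := hP' 3
    rw [hs 1 0, hs 2 0, hs 3 0] at P0
    rw [hs 2 1, hs 3 1] at P1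
    rw [hs 3 2] at P2
    obtain ⟨p1, p2, p3, p4, p5⟩ := hp
    obtain ⟨E1, E2, E3, E4, E5⟩ := scal x y z (h 1 1) (h 1 2) (h 1 3) (h 2 2) (h 2 3) (h 3 3)
      (h 0 0) (h 0 1) (h 0 2) (h 0 3) P0 P1 P2 P3 p1 p2 p3 p4 p5 _ _ _ _ _ _ rfl rfl rfl rfl rfl rfl
    obtain ⟨q, q1, q2, q3, q4, q5, q6⟩ := main _ _ _ _ _ _ E1 E2 E3 E4 E5
    rcases adj_case _ _ _ _ _ _ n1 n2 n3 q hn q1 q2 q3 q4 q5 q6 with hh | hh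
    · left
      obtain ⟨k1, k2, k3⟩ := hh
      intro j
      simp only [Fin.sum_univ_four]
      simp
      fin_cases j <;> simp only [Fin.zero_eta, Fin.mk_one, Fin.reduceFinMk]
      · rw [hs 1 0, hs 2 0, hs 3 0]
        linear_combination n1 * P1 + n2 * P2 + n3 * P3 - x * k1 - y * k2 - z * k3
      · rw [hs 2 1, hs 3 1]; exact k1
      · rw [hs 3 2]; exact k2
      · exact k3
    · right
      exact extend4 x y z h hs hP' hh

theorem goodP_1 [IsAlgClosed k] (y : k) : GoodP ![0, 1, y, 0] := by
  refine ⟨![1, 0, -y ^ 2, -y ^ 3], ?_, ?_⟩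
  · intro a b hab
    have h0 := hab 0
    have h1 := hab 1
    simp at h0 h1
    subst h0
    simpa using h1
  · intro h hs hp hP
    have hP' : ∀ j, h 1 j + y * h 2 j = 0 := fun j => by
      rw [← hP j]; simp [Fin.sum_univ_four]
    have P0 : h 0 1 = -(y * h 0 2) := by rw [hs 0 1, hs 0 2]; linear_combination hP' 0
    have P2 : h 1 2 = -(y * h 2 2) := by linear_combination hP' 2
    have P1 : h 1 1 = -(y * h 1 2) := by rw [hs 1 2]; linear_combination hP' 1
    have P3 : h 1 3 = -(y * h 2 3) := by linear_combination hP' 3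
    obtain ⟨p1, p2, p3, p4, p5⟩ := hp
    rw [P2] at P1
    rw [P0, P1, P2, P3] at p1
    rw [P0, P1, P3] at p2
    rw [P2, P3] at p3
    rw [P0, P3] at p4
    rw [P1, P2, P3] at p5
    have s1 := hs 1 0
    have s2 := hs 2 0
    have s3 := hs 3 0
    have s4 := hs 2 1
    have s5 := hs 3 1
    have s6 := hs 3 2
    have q0 : h 0 3 * h 2 3 - h 0 2 * h 3 3 = (h 2 2 * h 3 3 - h 2 3 * h 2 3) * 1 * -y ^ 2 := by
      linear_combination p5
    have q1 : h 0 2 * h 2 3 - h 0 3 * h 2 2 = (h 2 2 * h 3 3 - h 2 3 * h 2 3) * 1 * -y ^ 3 := by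
      linear_combination - p4 + y * p5
    have q2 : h 0 0 * h 3 3 - h 0 3 * h 0 3 =
        (h 2 2 * h 3 3 - h 2 3 * h 2 3) * -y ^ 2 * -y ^ 2 := by
      linear_combination p3 - y * q1
    have q3 : h 0 2 * h 0 3 - h 0 0 * h 2 3 =
        (h 2 2 * h 3 3 - h 2 3 * h 2 3) * -y ^ 2 * -y ^ 3 := by
      linear_combination - p2 - y ^ 2 * q1
    have q4 : h 0 0 * h 2 2 - h 0 2 * h 0 2 =
        (h 2 2 * h 3 3 - h 2 3 * h 2 3) * -y ^ 3 * -y ^ 3 := by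
      linear_combination p1 + y * q3
    rcases adj_case (h 0 0) (h 0 2) (h 0 3) (h 2 2) (h 2 3) (h 3 3) 1 (-y ^ 2) (-y ^ 3)
      (h 2 2 * h 3 3 - h 2 3 * h 2 3) (Or.inl rfl) (by ring) q0 q1 q2 q3 q4 with hh | hh
    · left
      obtain ⟨k1, k2, k3⟩ := hh
      intro j
      simp only [Fin.sum_univ_four]
      simp
      fin_cases j <;> simp only [Fin.zero_eta, Fin.mk_one, Fin.reduceFinMk]
      · rw [s2, s3]; linear_combination k1
      · rw [s4, s5, P0, P2, P3]; linear_combination -y * k2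
      · rw [s6]; linear_combination k2
      · linear_combination k3
    · right
      obtain ⟨a, b, c, h1, h2, h3, h4, h5, h6⟩ := hh
      refine ⟨![a, -(y * b), b, c], fun i j => ?_⟩
      fin_cases i <;> fin_cases j <;> simp <;> grind

/-- Off the twisted cubic, `P` is good. -/
theorem goodP_all [IsAlgClosed k] (P : Fin 4 → k)
    (hP : ¬ ∃ a b : k, P = ![a ^ 3, a ^ 2 * b, a * b ^ 2, b ^ 3]) : GoodP P := by
  have case0 : ∀ P : Fin 4 → k, (¬ ∃ a b : k, P = ![a ^ 3, a ^ 2 * b, a * b ^ 2, b ^ 3]) →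
      P 0 ≠ 0 → GoodP P := by
    intro P hP h0
    apply goodP_smul P (P 0)⁻¹ (inv_ne_zero h0)
    have : (fun i => (P 0)⁻¹ * P i) = ![1, P 1 / P 0, P 2 / P 0, P 3 / P 0] := by
      funext i
      fin_cases i <;> simp [h0] <;> field_simp
    rw [this]
    apply goodP_0
    by_contra! hc
    apply hP
    obtain ⟨a, ha⟩ := IsAlgClosed.exists_pow_nat_eq (P 0) (n := 3) (by norm_num)
    have ha0 : a ≠ 0 := by rintro rfl; apply h0; rw [← ha]; simp
    obtain ⟨c1, c2⟩ := hc
    refine ⟨a, P 1 / P 0 * a, ?_⟩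
    have e2 : P 2 = P 1 ^ 2 / P 0 := by
      field_simp at c1 ⊢
      linear_combination c1
    have e3 : P 3 = P 1 ^ 3 / P 0 ^ 2 := by
      rw [e2] at c2
      field_simp at c2 ⊢
      linear_combination c2
    funext i
    fin_cases i
    · simp [ha]
    · simp; rw [← ha]; field_simp
    · simp [e2]; rw [← ha]; field_simp
    · simp [e3]; rw [← ha]; field_simp
  have hrev : ¬ ∃ a b : k, (fun i => P (Fin.rev i)) = ![a ^ 3, a ^ 2 * b, a * b ^ 2, b ^ 3] := by
    rintro ⟨a, b, hab⟩
    apply hP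
    refine ⟨b, a, ?_⟩
    funext i
    have := congrFun hab (Fin.rev i)
    simp only [Fin.rev_rev] at this
    rw [this]
    fin_cases i
    · rfl
    · change a * b ^ 2 = b ^ 2 * a
      ring
    · change a ^ 2 * b = b * a ^ 2
      ring
    · rfl
  by_cases h0 : P 0 = 0
  · by_cases h3 : P 3 = 0
    · by_cases h1 : P 1 = 0
      · have h2 : P 2 ≠ 0 := by
          intro h2
          apply hP
          refine ⟨0, 0, ?_⟩
          funext i
          fin_cases i <;> simp [h0, h1, h2, h3]
        apply goodP_rev
        apply goodP_smul _ (P 2)⁻¹ (inv_ne_zero h2)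
        convert goodP_1 (0 : k) using 1
        funext i
        fin_cases i
        · simp; right; exact h3
        · simp; exact inv_mul_cancel₀ h2
        · simp; right; exact h1
        · simp; right; exact h0
      · apply goodP_smul _ (P 1)⁻¹ (inv_ne_zero h1)
        convert goodP_1 (P 2 / P 1) using 1
        funext i
        fin_cases i
        · simp [h0]
        · simp [h1]
        · simp; field_simp
        · simp [h3]
    · exact goodP_rev P (case0 _ hrev h3)
  · exact case0 P hP h0
end PartOne

section PartTwo
variable {k : Type*} [Field k]

def wd (v w : Fin 5 → k) : Matrix (Fin 5) (Fin 5) k := Matrix.of fun i j => v i * w j - v j * w i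

def SA : Matrix (Fin 5) (Fin 4) k :=
  !![1, 0, 0, 0; 0, 1, 0, 0; 0, 0, 1, 0; 0, 0, 0, 1; 0, 0, 0, 0]
def TA : Matrix (Fin 5) (Fin 4) k :=
  !![0, 0, 0, 0; 1, 0, 0, 0; 0, 1, 0, 0; 0, 0, 1, 0; 0, 0, 0, 1]
def SB : Matrix (Fin 5) (Fin 3) k :=
  !![1, 0, 0; 0, 0, 0; 0, 1, 0; 0, 0, 1; 0, 0, 0]
def TB : Matrix (Fin 5) (Fin 3) k :=
  !![0, 0, 0; 1, 0, 0; 0, 0, 0; 0, 1, 0; 0, 0, 1]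

theorem SA_mulVec (f : Fin 4 → k) : SA.mulVec f = ![f 0, f 1, f 2, f 3, 0] := by
  funext i
  fin_cases i <;> simp [SA, Matrix.mulVec, dotProduct, Fin.sum_univ_four]
theorem TA_mulVec (f : Fin 4 → k) : TA.mulVec f = ![0, f 0, f 1, f 2, f 3] := by
  funext i
  fin_cases i <;> simp [TA, Matrix.mulVec, dotProduct, Fin.sum_univ_four]
theorem SB_mulVec (f : Fin 3 → k) : SB.mulVec f = ![f 0, 0, f 1, f 2, 0] := by
  funext i
  fin_cases i <;> simp [SB, Matrix.mulVec, dotProduct, Fin.sum_univ_three]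
theorem TB_mulVec (f : Fin 3 → k) : TB.mulVec f = ![0, f 0, 0, f 1, f 2] := by
  funext i
  fin_cases i <;> simp [TB, Matrix.mulVec, dotProduct, Fin.sum_univ_three]

def sqm {n : ℕ} (v : Fin n → k) : Matrix (Fin n) (Fin n) k := Matrix.of fun i j => v i * v j

theorem sqm_eq {n : ℕ} (v : Fin n → k) : sqm v = Matrix.vecMulVec v v := by
  ext i j; simp [sqm, Matrix.vecMulVec]

theorem wd_eq (v w : Fin 5 → k) : wd v w = Matrix.vecMulVec v w - Matrix.vecMulVec w v := by
  ext i j; simp [wd, Matrix.vecMulVec]; ring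

/-- `X ↦ S X Tᵀ - T X Sᵀ`. -/
def LL {n : ℕ} (S T : Matrix (Fin 5) (Fin n) k) :
    Matrix (Fin n) (Fin n) k →ₗ[k] Matrix (Fin 5) (Fin 5) k where
  toFun X := S * X * T.transpose - T * X * S.transpose
  map_add' X Y := by simp only [Matrix.mul_add, Matrix.add_mul]; abel
  map_smul' r X := by simp [smul_sub]

theorem LL_sqm {n : ℕ} (S T : Matrix (Fin 5) (Fin n) k) (v : Fin n → k) :
    LL S T (sqm v) = wd (S.mulVec v) (T.mulVec v) := by
  rw [sqm_eq, wd_eq]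
  simp only [LL, LinearMap.coe_mk, AddHom.coe_mk, Matrix.mul_vecMulVec, Matrix.vecMulVec_mul,
    Matrix.vecMul_transpose]

def hA : Matrix (Fin 5) (Fin 5) k →ₗ[k] Matrix (Fin 4) (Fin 4) k where
  toFun o := !![o 0 1, o 0 2, o 0 3, o 0 4;
    o 0 2, o 1 2 + o 0 3, o 1 3 + o 0 4, o 1 4;
    o 0 3, o 1 3 + o 0 4, o 2 3 + o 1 4, o 2 4;
    o 0 4, o 1 4, o 2 4, o 3 4]
  map_add' X Y := by
    ext i j
    fin_cases i <;> fin_cases j <;> simp <;> ring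
  map_smul' r X := by
    ext i j
    fin_cases i <;> fin_cases j <;> simp <;> ring

def hB : Matrix (Fin 5) (Fin 5) k →ₗ[k] Matrix (Fin 3) (Fin 3) k where
  toFun o := !![o 0 1, o 0 3, o 0 4; o 0 3, o 2 3, o 2 4; o 0 4, o 2 4, o 3 4]
  map_add' X Y := by
    ext i j
    fin_cases i <;> fin_cases j <;> simp
  map_smul' r X := by
    ext i j
    fin_cases i <;> fin_cases j <;> simp

theorem hA_wd (f : Fin 4 → k) : hA (wd (SA.mulVec f) (TA.mulVec f)) = sqm f := by
  rw [SA_mulVec, TA_mulVec]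
  ext i j
  fin_cases i <;> fin_cases j <;> simp [hA, wd, sqm] <;> ring

theorem hB_wd (f : Fin 3 → k) : hB (wd (SB.mulVec f) (TB.mulVec f)) = sqm f := by
  rw [SB_mulVec, TB_mulVec]
  ext i j
  fin_cases i <;> fin_cases j <;> simp [hB, wd, sqm] <;> ring

theorem LL_apply {n : ℕ} (S T : Matrix (Fin 5) (Fin n) k) (X : Matrix (Fin n) (Fin n) k)
    (i j : Fin 5) : LL S T X i j = ∑ b, ((∑ a, S i a * X a b) * T j b) -
      ∑ b, ((∑ a, T i a * X a b) * S j b) := by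
  simp [LL, Matrix.mul_apply]

theorem LL_hA (v w : Fin 5 → k) : LL SA TA (hA (wd v w)) = wd v w := by
  ext i j
  rw [LL_apply]
  simp only [Fin.sum_univ_four]
  fin_cases i <;> fin_cases j <;> simp [hA, wd, SA, TA]

theorem wd_mulVec (M : Matrix (Fin 5) (Fin 5) k) (v w : Fin 5 → k) :
    wd (M.mulVec v) (M.mulVec w) = M * wd v w * M.transpose := by
  simp only [wd_eq, Matrix.mul_sub, Matrix.sub_mul, Matrix.mul_vecMulVec, Matrix.vecMulVec_mul,
    Matrix.vecMul_transpose]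

theorem hA_symm (v w : Fin 5 → k) (i j : Fin 4) : hA (wd v w) i j = hA (wd v w) j i := by
  fin_cases i <;> fin_cases j <;> simp [hA]

theorem hA_pl (v w : Fin 5 → k) : PlRel (hA (wd v w)) := by
  refine ⟨?_, ?_, ?_, ?_, ?_⟩ <;> simp [hA, wd] <;> ring

/-- Left inverse for the `B`-side. -/
def hBN (N : Matrix (Fin 5) (Fin 5) k) :
    Matrix (Fin 5) (Fin 5) k →ₗ[k] Matrix (Fin 3) (Fin 3) k where
  toFun o := hB (N * o * N.transpose)
  map_add' X Y := by simp only [Matrix.mul_add, Matrix.add_mul, map_add]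
  map_smul' r X := by simp

theorem hBN_wd (M N : Matrix (Fin 5) (Fin 5) k) (hNM : N * M = 1) (f : Fin 3 → k) :
    hBN N (wd ((M * (SB : Matrix (Fin 5) (Fin 3) k)).mulVec f)
      ((M * (TB : Matrix (Fin 5) (Fin 3) k)).mulVec f)) = sqm f := by
  rw [← Matrix.mulVec_mulVec, ← Matrix.mulVec_mulVec, ← hB_wd f]
  simp only [hBN, LinearMap.coe_mk, AddHom.coe_mk]
  rw [← wd_mulVec]
  simp only [Matrix.mulVec_mulVec, ← Matrix.mul_assoc, hNM, Matrix.one_mul]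

/-- isotropic subspaces have at most half the dimension -/
theorem rank_half {n : ℕ} (v : Fin 7 → Fin n → k) (c : Fin 7 → k)
    (h : ∑ i, c i • sqm (v i) = 0) (I : Finset (Fin 7)) (hI : ∀ i, i ∈ I ↔ c i ≠ 0) :
    2 * Module.finrank k (Submodule.span k (Set.range fun i : I => v i)) ≤ I.card := by
  classical
  let X : Matrix I (Fin n) k := Matrix.of fun i a => v i a
  let D : Matrix I I k := Matrix.diagonal fun i => c i
  have hX : X.rank = Module.finrank k (Submodule.span k (Set.range fun i : I => v i)) := by
    rw [Matrix.rank_eq_finrank_span_row]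
    rfl
  have hD : IsUnit D := by
    rw [Matrix.isUnit_iff_isUnit_det, Matrix.det_diagonal]
    rw [isUnit_iff_ne_zero, Finset.prod_ne_zero_iff]
    intro i _
    exact (hI i).1 i.2
  have h0 : (X.transpose * D) * X = 0 := by
    ext a b
    have := congrFun (congrFun h a) b
    simp only [Matrix.sum_apply, Matrix.smul_apply, sqm, Matrix.of_apply, smul_eq_mul,
      Matrix.zero_apply] at this
    rw [Matrix.mul_apply]
    simp only [D, X, Matrix.mul_diagonal, Matrix.transpose_apply, Matrix.of_apply,
      Matrix.zero_apply]
    rw [← this, Finset.sum_coe_sort I (fun i => v i a * c i * v i b)]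
    rw [← Finset.sum_subset (Finset.subset_univ I)]
    · apply Finset.sum_congr rfl
      intros; ring
    · intro i _ hi
      rw [hI, not_not] at hi
      simp [hi]
  have h1 := Matrix.rank_add_rank_le_card_of_mul_eq_zero h0
  rw [Matrix.rank_mul_eq_left_of_isUnit_det _ _ ((Matrix.isUnit_iff_isUnit_det _).1 hD),
    Matrix.rank_transpose, hX] at h1
  simp only [Fintype.card_coe] at h1
  omega

def s6 (w : Fin 3 → k) : Fin 6 → k :=
  ![w 0 * w 0, w 0 * w 1, w 0 * w 2, w 1 * w 1, w 1 * w 2, w 2 * w 2]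

def L6 : (Fin 6 → k) →ₗ[k] Matrix (Fin 3) (Fin 3) k where
  toFun x := !![x 0, x 1, x 2; x 1, x 3, x 4; x 2, x 4, x 5]
  map_add' X Y := by
    ext i j
    fin_cases i <;> fin_cases j <;> simp
  map_smul' r X := by
    ext i j
    fin_cases i <;> fin_cases j <;> simp

theorem L6_s6 (w : Fin 3 → k) : L6 (s6 w) = sqm w := by
  ext i j
  fin_cases i <;> fin_cases j <;> simp [L6, s6, sqm] <;> ring

theorem L6_inj (x : Fin 6 → k) (h : L6 x = 0) : x = 0 := by
  funext i
  have h' := fun a b => congrFun (congrFun h a) b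
  have h00 := h' 0 0
  have h01 := h' 0 1
  have h02 := h' 0 2
  have h11 := h' 1 1
  have h12 := h' 1 2
  have h22 := h' 2 2
  simp [L6] at h00 h01 h02 h11 h12 h22
  fin_cases i <;> simp [*]

theorem lin6 (l : (Fin 6 → k) →ₗ[k] k) : ∃ c : Fin 6 → k, ∀ x, l x = ∑ i, c i * x i := by
  refine ⟨fun i => l (Pi.single i 1), fun x => ?_⟩
  conv_lhs => rw [pi_eq_sum_univ' x]
  rw [map_sum]
  apply Finset.sum_congr rfl
  intro i _
  rw [map_smul, smul_eq_mul, mul_comm]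

theorem poly_curve (l : (Fin 6 → k) →ₗ[k] k) (x0 x1 x2 : Fin 3 → k) :
    ∃ p : Polynomial k, ∀ t, p.eval t = l (s6 (x0 + t • x1 + t ^ 2 • x2)) := by
  obtain ⟨c, hc⟩ := lin6 l
  let y : Fin 3 → Polynomial k := fun i =>
    Polynomial.C (x0 i) + Polynomial.X * Polynomial.C (x1 i) +
      Polynomial.X ^ 2 * Polynomial.C (x2 i)
  refine ⟨Polynomial.C (c 0) * (y 0 * y 0) + Polynomial.C (c 1) * (y 0 * y 1) +
    Polynomial.C (c 2) * (y 0 * y 2) + Polynomial.C (c 3) * (y 1 * y 1) +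
    Polynomial.C (c 4) * (y 1 * y 2) + Polynomial.C (c 5) * (y 2 * y 2), fun t => ?_⟩
  rw [hc, Fin.sum_univ_six]
  simp [y, s6]
  ring

theorem exists_curve [IsAlgClosed k] (l : (Fin 6 → k) →ₗ[k] k) (w0 : Fin 3 → k) (hw0 : w0 ≠ 0)
    (h0 : l (s6 w0) = 0) : ∃ x0 x1 x2 : Fin 3 → k, ∃ r : k, r ≠ 0 ∧ x0 = r • w0 ∧
      (∀ t : k, l (s6 (x0 + t • x1 + t ^ 2 • x2)) = 0) ∧
      (∀ t t' : k, t ≠ 0 → t' ≠ 0 → t ≠ t' → ∀ a b : k,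
        a • (x0 + t • x1 + t ^ 2 • x2) + b • (x0 + t' • x1 + t' ^ 2 • x2) = 0 →
        a = 0 ∧ b = 0) := by
  obtain ⟨c, hc⟩ := lin6 l
  let q : (Fin 3 → k) → k := fun w => l (s6 w)
  let B : (Fin 3 → k) → (Fin 3 → k) →ₗ[k] k := fun v =>
    (2 * c 0 * v 0 + c 1 * v 1 + c 2 * v 2) • LinearMap.proj 0 +
    (c 1 * v 0 + 2 * c 3 * v 1 + c 4 * v 2) • LinearMap.proj 1 +
    (c 2 * v 0 + c 4 * v 1 + 2 * c 5 * v 2) • LinearMap.proj 2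
  have hq2 : ∀ (a b : k) (v w : Fin 3 → k),
      q (a • v + b • w) = a ^ 2 * q v + a * b * B v w + b ^ 2 * q w := by
    intro a b v w
    simp [q, hc, B, Fin.sum_univ_six, s6]
    ring
  have hq3 : ∀ (a b d : k) (u v w : Fin 3 → k),
      q (a • u + b • v + d • w) = a ^ 2 * q u + b ^ 2 * q v + d ^ 2 * q w + a * b * B u v
        + a * d * B u w + b * d * B v w := by
    intro a b d u v w
    simp [q, hc, B, Fin.sum_univ_six, s6]
    ring
  have hBself : B w0 w0 = 0 := by
    have : B w0 w0 = 2 * q w0 := by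
      simp [q, hc, B, Fin.sum_univ_six, s6]
      ring
    rw [this]; simp [q, h0]
  -- line case
  have line : ∀ v : Fin 3 → k, (∀ a b : k, a • w0 + b • v = 0 → a = 0 ∧ b = 0) → B w0 v = 0 →
      q v = 0 → ∃ x0 x1 x2 : Fin 3 → k, ∃ r : k, r ≠ 0 ∧ x0 = r • w0 ∧
      (∀ t : k, l (s6 (x0 + t • x1 + t ^ 2 • x2)) = 0) ∧
      (∀ t t' : k, t ≠ 0 → t' ≠ 0 → t ≠ t' → ∀ a b : k,
        a • (x0 + t • x1 + t ^ 2 • x2) + b • (x0 + t' • x1 + t' ^ 2 • x2) = 0 →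
        a = 0 ∧ b = 0) := by
    intro v hv hB hqv
    refine ⟨w0, v, 0, 1, one_ne_zero, by simp, fun t => ?_, fun t t' ht ht' htt a b hab => ?_⟩
    · have := hq2 1 t w0 v
      simp only [one_smul, hB, hqv] at this
      have h0' : q w0 = 0 := h0
      simpa [q, h0] using this
    · have := hv (a + b) (a * t + b * t') (by rw [← hab]; module)
      obtain ⟨e1, e2⟩ := this
      have hb : b = -a := by linear_combination e1
      subst hb
      have : a * (t - t') = 0 := by linear_combination e2
      have ha := (mul_eq_zero.1 this).resolve_right (sub_ne_zero.2 htt)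
      simp [ha]
  -- find v1
  obtain ⟨v1, hv1, hBv1⟩ : ∃ v1, v1 ∉ Submodule.span k {w0} ∧ B w0 v1 = 0 := by
    by_contra! hcon
    have hle : LinearMap.ker (B w0) ≤ Submodule.span k {w0} := by
      intro v hv
      by_contra hn
      exact hcon v hn hv
    have h1 := Submodule.finrank_mono hle
    rw [finrank_span_singleton hw0] at h1
    have h2 := LinearMap.finrank_range_add_finrank_ker (B w0)
    have h3 : Module.finrank k (LinearMap.range (B w0)) ≤ 1 := by
      simpa using Submodule.finrank_le (LinearMap.range (B w0))
    simp at h2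
    omega
  obtain ⟨v2, hv2⟩ : ∃ v2, v2 ∉ Submodule.span k {w0, v1} := by
    by_contra! hcon
    have htop : Submodule.span k {w0, v1} = ⊤ := by
      rw [eq_top_iff]; intro v _; exact hcon v
    classical
    have h1 := finrank_span_finset_le_card (R := k) ({w0, v1} : Finset (Fin 3 → k))
    unfold Set.finrank at h1
    rw [Finset.coe_pair, htop] at h1
    have h2 : ({w0, v1} : Finset (Fin 3 → k)).card ≤ 2 := Finset.card_le_two
    simp only [finrank_top, Module.finrank_fin_fun] at h1
    omega
  have hind2 : ∀ a b : k, a • w0 + b • v1 = 0 → a = 0 ∧ b = 0 := by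
    intro a b hab
    have hb : b = 0 := by
      by_contra hb
      apply hv1
      rw [Submodule.mem_span_singleton]
      refine ⟨-(b⁻¹ * a), ?_⟩
      have : b⁻¹ • (a • w0 + b • v1) = 0 := by rw [hab, smul_zero]
      rw [smul_add, smul_smul, smul_smul, inv_mul_cancel₀ hb, one_smul] at this
      rw [neg_smul]
      exact (eq_neg_of_add_eq_zero_right this).symm
    subst hb
    simpa [hw0] using hab
  have hind3 : ∀ a b d : k, a • w0 + b • v1 + d • v2 = 0 → a = 0 ∧ b = 0 ∧ d = 0 := by
    intro a b d hab
    have hd : d = 0 := by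
      by_contra hd
      apply hv2
      rw [Submodule.mem_span_pair]
      refine ⟨-(d⁻¹ * a), -(d⁻¹ * b), ?_⟩
      have : d⁻¹ • (a • w0 + b • v1 + d • v2) = 0 := by rw [hab, smul_zero]
      rw [smul_add, smul_add, smul_smul, smul_smul, smul_smul, inv_mul_cancel₀ hd, one_smul] at this
      rw [neg_smul, neg_smul, eq_neg_of_add_eq_zero_right this]
      abel
    subst hd
    have := hind2 a b (by simpa using hab)
    simp [this]
  by_cases hqv1 : q v1 = 0
  · exact line v1 hind2 hBv1 hqv1
  by_cases hbeta : B w0 v2 = 0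
  · obtain ⟨s, hs⟩ : ∃ s : k, q v2 + s * B v1 v2 + s ^ 2 * q v1 = 0 := by
      obtain ⟨s, hs⟩ := IsAlgClosed.exists_root
        (Polynomial.C (q v1) * Polynomial.X ^ 2 + Polynomial.C (B v1 v2) * Polynomial.X +
          Polynomial.C (q v2)) (by rw [Polynomial.degree_quadratic hqv1]; norm_num)
      refine ⟨s, ?_⟩
      simp [Polynomial.IsRoot] at hs
      linear_combination hs
    refine line (s • v1 + (1 : k) • v2) ?_ ?_ ?_
    · intro a b hab
      have := hind3 a (b * s) b (by rw [← hab]; module)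
      exact ⟨this.1, this.2.2⟩
    · rw [map_add, map_smul, map_smul, hBv1, hbeta]; simp
    · rw [hq2]; linear_combination hs
  · refine ⟨q v1 • w0, B v1 v2 • w0 - B w0 v2 • v1, q v2 • w0 - B w0 v2 • v2, q v1, hqv1, rfl,
      fun t => ?_, fun t t' ht ht' htt a b hab => ?_⟩
    · have e : q v1 • w0 + t • (B v1 v2 • w0 - B w0 v2 • v1) + t ^ 2 • (q v2 • w0 - B w0 v2 • v2)
        = (q v1 + t * B v1 v2 + t ^ 2 * q v2) • w0 + (-t * B w0 v2) • v1
          + (-t ^ 2 * B w0 v2) • v2 := by module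
      rw [e]
      change q _ = 0
      rw [hq3, hBv1, show q w0 = 0 from h0]
      ring
    · have := hind3 (a * (q v1 + t * B v1 v2 + t ^ 2 * q v2) +
        b * (q v1 + t' * B v1 v2 + t' ^ 2 * q v2))
        (-(a * t + b * t') * B w0 v2) (-(a * t ^ 2 + b * t' ^ 2) * B w0 v2)
        (by rw [← hab]; module)
      obtain ⟨-, e1, e2⟩ := this
      have e1' := (mul_eq_zero.1 e1).resolve_right hbeta
      have e2' := (mul_eq_zero.1 e2).resolve_right hbeta
      have hb : b = 0 := by
        have : b * (t' * (t' - t)) = 0 := by linear_combination t * e1' - e2'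
        exact (mul_eq_zero.1 this).resolve_right (mul_ne_zero ht' (sub_ne_zero.2 htt.symm))
      have ha : a = 0 := by
        have : a * (t * (t - t')) = 0 := by linear_combination t' * e1' - e2'
        exact (mul_eq_zero.1 this).resolve_right (mul_ne_zero ht (sub_ne_zero.2 htt))
      exact ⟨ha, hb⟩

theorem prop_of_ker {v : Fin 5 → Fin 6 → k} (hv : LinearIndependent k v)
    (l l' : (Fin 6 → k) →ₗ[k] k) (hl : l ≠ 0) (h : ∀ i, l (v i) = 0) (h' : ∀ i, l' (v i) = 0) :
    ∃ r : k, l' = r • l := by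
  have hspan : Submodule.span k (Set.range v) ≤ LinearMap.ker l := by
    rw [Submodule.span_le]; rintro _ ⟨i, rfl⟩; exact h i
  have hspan' : Submodule.span k (Set.range v) ≤ LinearMap.ker l' := by
    rw [Submodule.span_le]; rintro _ ⟨i, rfl⟩; exact h' i
  have hfr := finrank_span_eq_card hv
  obtain ⟨x, hx⟩ : ∃ x, l x ≠ 0 := by
    by_contra! hc
    exact hl (LinearMap.ext hc)
  have heq : Submodule.span k (Set.range v) = LinearMap.ker l := by
    apply Submodule.eq_of_le_of_finrank_le hspan
    rw [hfr]
    have h2 := LinearMap.finrank_range_add_finrank_ker l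
    have h3 : 0 < Module.finrank k (LinearMap.range l) := by
      rw [Module.finrank_pos_iff]
      exact ⟨⟨l x, x, rfl⟩, 0, fun hh => hx (by simpa using congrArg Subtype.val hh)⟩
    simp at h2 ⊢
    omega
  refine ⟨l' x / l x, LinearMap.ext fun y => ?_⟩
  have hy : y - (l y / l x) • x ∈ LinearMap.ker l' := by
    apply hspan'
    rw [heq, LinearMap.mem_ker, map_sub, map_smul, smul_eq_mul]
    field_simp
    ring
  rw [LinearMap.mem_ker, map_sub, map_smul, smul_eq_mul] at hy
  simp only [LinearMap.smul_apply, smul_eq_mul]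
  field_simp at hy ⊢
  linear_combination hy

end PartTwo

section PartThree
variable {k : Type*} [Field k]

theorem pair_rank {n m : ℕ} (w : Fin m → Fin n → k) (I : Finset (Fin m)) (i j : Fin m) (hi : i ∈ I)
    (hj : j ∈ I) (h : ∀ r s : k, r • w i + s • w j = 0 → r = 0 ∧ s = 0) :
    2 ≤ Module.finrank k (Submodule.span k (Set.range fun i : I => w i)) := by
  have hli : LinearIndependent k ![w i, w j] := by
    rw [LinearIndependent.pair_iff]; exact h
  have h1 := finrank_span_eq_card hli
  refine le_of_eq_of_le h1.symm ?_
  apply Submodule.finrank_mono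
  apply Submodule.span_mono
  rintro _ ⟨a, rfl⟩
  fin_cases a
  · exact ⟨⟨i, hi⟩, rfl⟩
  · exact ⟨⟨j, hj⟩, rfl⟩

theorem extend_sum {E : Type*} [AddCommGroup E] [Module k E] {m : ℕ} (e : Fin m → Fin 7)
    (he : Function.Injective e)
    (g : Fin m → k) (x : Fin 7 → E) :
    ∑ i, Function.extend e g 0 i • x i = ∑ a, g a • x (e a) := by
  classical
  rw [← Finset.sum_subset (Finset.subset_univ (Finset.univ.image e))]
  · rw [Finset.sum_image (fun a _ b _ h => he h)]
    apply Finset.sum_congr rfl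
    intro a _
    rw [he.extend_apply]
  · intro i _ hi
    rw [Function.extend_apply']
    · simp
    · rintro ⟨a, rfl⟩
      exact hi (Finset.mem_image_of_mem _ (Finset.mem_univ _))

theorem core_step1 (u : Fin 7 → Fin 4 → k) (w : Fin 7 → Fin 3 → k)
    (hw : ∀ i j, i ≠ j → ∀ r s : k, r • w i + s • w j = 0 → r = 0 ∧ s = 0)
    (c : Fin 7 → k) (I : Finset (Fin 7)) (hI : ∀ i, i ∈ I ↔ c i ≠ 0) (hc : c ≠ 0)
    (hu : ∑ i, c i • sqm (u i) = 0) (hww : ∑ i, c i • sqm (w i) = 0) (hcard : I.card ≤ 5) :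
    ∃ e : Fin 4 → Fin 7, Function.Injective e ∧
      Module.finrank k (Submodule.span k (Set.range (u ∘ e))) ≤ 2 ∧
      Module.finrank k (Submodule.span k (Set.range (w ∘ e))) ≤ 2 := by
  have h1 := rank_half u c hu I hI
  have h2 := rank_half w c hww I hI
  have h4 : 4 ≤ I.card := by
    by_cases h : 1 < I.card
    · obtain ⟨i, hi, j, hj, hij⟩ := Finset.one_lt_card.1 h
      have := pair_rank w I i j hi hj (hw i j hij)
      omega
    · exfalso
      have hne : ∃ i, c i ≠ 0 := by
        by_contra! hh; exact hc (funext hh)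
      obtain ⟨i, hi⟩ := hne
      have hiI := (hI i).2 hi
      have : 0 < I.card := Finset.card_pos.2 ⟨i, hiI⟩
      have h0 : Module.finrank k (Submodule.span k (Set.range fun i : I => w i)) = 0 := by omega
      have hwi : w i ∈ Submodule.span k (Set.range fun i : I => w i) :=
        Submodule.subset_span ⟨⟨i, hiI⟩, rfl⟩
      rw [Submodule.finrank_eq_zero] at h0
      rw [h0, Submodule.mem_bot] at hwi
      obtain ⟨j, hj⟩ : ∃ j : Fin 7, i ≠ j := by
        by_cases h : i = 0
        · exact ⟨1, by rw [h]; decide⟩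
        · exact ⟨0, h⟩
      have := hw i j hj 1 0 (by rw [hwi]; simp)
      exact one_ne_zero this.1
  obtain ⟨J, hJI, hJ⟩ := Finset.exists_subset_card_eq h4
  refine ⟨J.orderEmbOfFin hJ, (J.orderEmbOfFin hJ).injective, ?_, ?_⟩
  · refine le_trans (Submodule.finrank_mono (Submodule.span_mono ?_)) (by omega : _ ≤ 2) (b :=
      Module.finrank k (Submodule.span k (Set.range fun i : I => u i)))
    rintro _ ⟨a, rfl⟩
    exact ⟨⟨J.orderEmbOfFin hJ a, hJI (Finset.orderEmbOfFin_mem _ _ _)⟩, rfl⟩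
  · refine le_trans (Submodule.finrank_mono (Submodule.span_mono ?_)) (by omega : _ ≤ 2) (b :=
      Module.finrank k (Submodule.span k (Set.range fun i : I => w i)))
    rintro _ ⟨a, rfl⟩
    exact ⟨⟨J.orderEmbOfFin hJ a, hJI (Finset.orderEmbOfFin_mem _ _ _)⟩, rfl⟩

theorem pq_dep (P Q : Fin 4 → k) (hPQ : ∀ r s : k, (∀ i, r * P i + s * Q i = 0) → r = 0 ∧ s = 0)
    (v : Fin 4 → Fin 4 → k) (hP : ∀ m, ∑ i, P i * v m i = 0) (hQ : ∀ m, ∑ i, Q i * v m i = 0) :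
    ∃ g : Fin 4 → k, g ≠ 0 ∧ ∑ m, g m • sqm (v m) = 0 := by
  let X : Matrix (Fin 2) (Fin 4) k := Matrix.of ![P, Q]
  have hX : X.rank = 2 := by
    have : LinearIndependent k X.row := by
      have h2 : LinearIndependent k ![P, Q] := by
        rw [LinearIndependent.pair_iff]
        intro r s h
        exact hPQ r s (fun i => by simpa using congrFun h i)
      exact h2
    simpa using this.rank_matrix
  let K := LinearMap.ker X.mulVecLin
  have hK : Module.finrank k K = 2 := by
    have := LinearMap.finrank_range_add_finrank_ker X.mulVecLin
    change X.rank + Module.finrank k K = _ at this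
    simp [hX] at this
    omega
  let b := Module.finBasisOfFinrankEq k K hK
  have hv : ∀ m, v m ∈ K := by
    intro m
    rw [LinearMap.mem_ker]
    funext a
    fin_cases a
    · simpa [X, Matrix.mulVec, dotProduct] using hP m
    · simpa [X, Matrix.mulVec, dotProduct] using hQ m
  have hex : ∀ m, ∃ x y : k, v m = x • (b 0 : Fin 4 → k) + y • (b 1 : Fin 4 → k) := by
    intro m
    have := b.sum_repr ⟨v m, hv m⟩
    rw [Fin.sum_univ_two] at this
    exact ⟨_, _, (congrArg Subtype.val this).symm⟩
  choose x y hxy using hex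
  let z : Fin 4 → Fin 3 → k := fun m => ![x m ^ 2, x m * y m, y m ^ 2]
  have hdep : ¬ LinearIndependent k z := by
    intro h
    have := h.fintype_card_le_finrank
    simp at this
  rw [Fintype.not_linearIndependent_iff] at hdep
  obtain ⟨g, hg, i, hi⟩ := hdep
  refine ⟨g, fun h => hi (by rw [h]; rfl), ?_⟩
  have g0 := congrFun hg 0
  have g1 := congrFun hg 1
  have g2 := congrFun hg 2
  simp [z, Fin.sum_univ_four] at g0 g1 g2
  ext i j
  simp only [hxy, sqm, Fin.sum_univ_four, Matrix.add_apply, Matrix.smul_apply, Matrix.of_apply,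
    Pi.add_apply, Pi.smul_apply, smul_eq_mul, Matrix.zero_apply]
  linear_combination (b 0 : Fin 4 → k) i * (b 0 : Fin 4 → k) j * g0 +
    ((b 0 : Fin 4 → k) i * (b 1 : Fin 4 → k) j + (b 1 : Fin 4 → k) i * (b 0 : Fin 4 → k) j) * g1 +
    (b 1 : Fin 4 → k) i * (b 1 : Fin 4 → k) j * g2

theorem wd_contract (φ v w : Fin 5 → k) (v' w' : Fin 5 → k) (h : wd v w = wd v' w')
    (h1 : ∑ i, φ i * v i = 0) (h2 : ∑ i, φ i * w i = 0) (hne : wd v' w' ≠ 0) :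
    ∑ i, φ i * v' i = 0 ∧ ∑ i, φ i * w' i = 0 := by
  have key : ∀ j, (∑ i, φ i * v' i) * w' j - (∑ i, φ i * w' i) * v' j = 0 := by
    intro j
    have e1 : ∑ i, φ i * wd v w i j = ∑ i, φ i * wd v' w' i j := by rw [h]
    simp only [wd, Matrix.of_apply, Fin.sum_univ_five] at e1 h1 h2 ⊢
    linear_combination -e1 + w j * h1 - v j * h2
  have key2 : ∀ i j, (∑ i, φ i * v' i) * wd v' w' i j = 0 ∧
      (∑ i, φ i * w' i) * wd v' w' i j = 0 := by
    intro i j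
    constructor
    · simp only [wd, Matrix.of_apply]
      linear_combination v' i * key j - v' j * key i
    · simp only [wd, Matrix.of_apply]
      linear_combination -w' j * key i + w' i * key j
  constructor
  · by_contra hn
    apply hne
    ext i j
    exact (mul_eq_zero.1 (key2 i j).1).resolve_left hn
  · by_contra hn
    apply hne
    ext i j
    exact (mul_eq_zero.1 (key2 i j).2).resolve_left hn

theorem core [IsAlgClosed k] (S T : Matrix (Fin 5) (Fin 3) k)
    (H : Matrix (Fin 5) (Fin 5) k →ₗ[k] Matrix (Fin 3) (Fin 3) k)
    (hH : ∀ f, H (wd (S.mulVec f) (T.mulVec f)) = sqm f)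
    (u : Fin 7 → Fin 4 → k) (w : Fin 7 → Fin 3 → k)
    (heq : ∀ i, wd (SA.mulVec (u i)) (TA.mulVec (u i)) = wd (S.mulVec (w i)) (T.mulVec (w i)))
    (hw : ∀ i j, i ≠ j → ∀ r s : k, r • w i + s • w j = 0 → r = 0 ∧ s = 0)
    (hdisj : ∀ a b : k, ¬ (a = 0 ∧ b = 0) → ∀ x y : Fin 3 → k,
      (∀ r s : k, r • x + s • y = 0 → r = 0 ∧ s = 0) → ∀ φ : Fin 5 → k,
      φ = ![a ^ 4, a ^ 3 * b, a ^ 2 * b ^ 2, a * b ^ 3, b ^ 4] →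
      ∑ i, φ i * S.mulVec x i = 0 → ∑ i, φ i * T.mulVec x i = 0 →
      ∑ i, φ i * S.mulVec y i = 0 → ∑ i, φ i * T.mulVec y i = 0 → False)
    (hfin : ∀ D : Set k, D.Infinite → ∀ c : k → Fin 3 → k,
      (∀ t ∈ D, c t ≠ 0 ∧ ∃ f, wd (SA.mulVec f) (TA.mulVec f) =
        wd (S.mulVec (c t)) (T.mulVec (c t))) →
      ∃ t ∈ D, ∃ t' ∈ D, t ≠ t' ∧ ∃ a b : k, ¬ (a = 0 ∧ b = 0) ∧ a • c t + b • c t' = 0) :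
    ∃ e : Fin 4 → Fin 7, Function.Injective e ∧
      Module.finrank k (Submodule.span k (Set.range (u ∘ e))) ≤ 2 ∧
      Module.finrank k (Submodule.span k (Set.range (w ∘ e))) ≤ 2 := by
  classical
  by_contra hcon
  have hrel : ∀ c : Fin 7 → k, ∑ i, c i • sqm (w i) = 0 → ∑ i, c i • sqm (u i) = 0 := by
    intro c hc
    have h1 : ∑ i, c i • wd (SA.mulVec (u i)) (TA.mulVec (u i)) = 0 := by
      simp only [heq, ← LL_sqm, ← map_smul, ← map_sum]
      rw [hc, map_zero]
    have h2 := congrArg hA h1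
    simpa only [map_sum, map_smul, hA_wd, map_zero] using h2
  have hrel' : ∀ c : Fin 7 → k, ∑ i, c i • sqm (u i) = 0 → ∑ i, c i • sqm (w i) = 0 := by
    intro c hc
    have h1 : ∑ i, c i • wd (S.mulVec (w i)) (T.mulVec (w i)) = 0 := by
      simp only [← heq, ← LL_sqm, ← map_smul, ← map_sum]
      rw [hc, map_zero]
    have h2 := congrArg H h1
    simpa only [map_sum, map_smul, hH, map_zero] using h2
  have hsupp : ∀ c : Fin 7 → k, c ≠ 0 → ∑ i, c i • sqm (w i) = 0 →
      6 ≤ (Finset.univ.filter fun i => c i ≠ 0).card := by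
    intro c hc h
    by_contra hn
    exact hcon (core_step1 u w hw c (Finset.univ.filter fun i => c i ≠ 0) (by simp) hc
      (hrel c h) h (by omega))
  have hsmall : ∀ (m : ℕ) (e : Fin m → Fin 7), m ≤ 5 → Function.Injective e → ∀ g : Fin m → k,
      ∑ a, g a • sqm (w (e a)) = 0 → g = 0 := by
    intro m e hm he g hg
    by_contra hne
    have h1 := hsupp (Function.extend e g 0) (by
      intro h0; apply hne; funext a
      have := congrFun h0 (e a)
      rwa [he.extend_apply] at this) (by
      rw [extend_sum e he g (fun i => sqm (w i))]; exact hg)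
    have h2 : (Finset.univ.filter fun i => Function.extend e g 0 i ≠ 0) ⊆ Finset.univ.image e := by
      intro i hi
      simp only [Finset.mem_filter, Finset.mem_univ, true_and] at hi
      by_contra hni
      apply hi
      rw [Function.extend_apply']
      · rfl
      · rintro ⟨a, rfl⟩; exact hni (Finset.mem_image_of_mem _ (Finset.mem_univ _))
    have h3 := Finset.card_le_card h2
    have h4 : (Finset.univ.image e).card ≤ m := by
      simpa using Finset.card_image_le (s := Finset.univ) (f := e)
    omega
  have hw0 : ∀ i, w i ≠ 0 := by
    intro i h
    have := hsmall 1 (fun _ => i) (by norm_num) (fun a b _ => Subsingleton.elim a b) (fun _ => 1)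
      (by rw [h]; ext a b; simp [sqm])
    exact one_ne_zero (congrFun this 0)
  have hsq0 : ∀ x : Fin 3 → k, x ≠ 0 → sqm x ≠ 0 := by
    intro x hx h
    apply hx
    funext i
    have := congrFun (congrFun h i) i
    simpa [sqm] using this
  -- the relation
  obtain ⟨c, hc0, hc⟩ : ∃ c : Fin 7 → k, c ≠ 0 ∧ ∑ i, c i • sqm (w i) = 0 := by
    have hdep : ¬ LinearIndependent k (fun i => s6 (w i)) := by
      intro h
      have := h.fintype_card_le_finrank
      simp at this
    rw [Fintype.not_linearIndependent_iff] at hdep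
    obtain ⟨g, hg, i, hi⟩ := hdep
    refine ⟨g, fun h => hi (by rw [h]; rfl), ?_⟩
    have := congrArg L6 hg
    simpa only [map_sum, map_smul, L6_s6, map_zero] using this
  set I := Finset.univ.filter fun i => c i ≠ 0 with hIdef
  have hI6 : 6 ≤ I.card := hsupp c hc0 hc
  have hI7 : I.card ≤ 7 := by simpa using Finset.card_le_univ I
  have hrk := rank_half u c (hrel c hc) I (by simp [hIdef])
  obtain ⟨P, hP0, hPu⟩ : ∃ P : Fin 4 → k, P ≠ 0 ∧ ∀ i ∈ I, ∑ a, P a * u i a = 0 := by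
    have hlt : Submodule.span k (Set.range fun i : I => u i) < ⊤ := by
      rw [lt_top_iff_ne_top]
      intro h
      rw [h] at hrk
      simp at hrk
      omega
    obtain ⟨f, hf0, hf⟩ := Submodule.exists_le_ker_of_lt_top _ hlt
    have hfx : ∀ x, f x = ∑ a, f (Pi.single a 1) * x a := by
      intro x
      conv_lhs => rw [pi_eq_sum_univ' x]
      rw [map_sum]
      apply Finset.sum_congr rfl
      intro i _
      rw [map_smul, smul_eq_mul, mul_comm]
    refine ⟨fun a => f (Pi.single a 1), ?_, ?_⟩
    · intro h
      apply hf0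
      ext x
      simpa using congrFun h x
    · intro i hi
      have : u i ∈ LinearMap.ker f := hf (Submodule.subset_span ⟨⟨i, hi⟩, rfl⟩)
      rw [LinearMap.mem_ker, hfx] at this
      exact this
  obtain ⟨J, hJI, hJ⟩ := Finset.exists_subset_card_eq hI6
  let e : Fin 6 → Fin 7 := J.orderEmbOfFin hJ
  have he : Function.Injective e := (J.orderEmbOfFin hJ).injective
  have heI : ∀ a, e a ∈ I := fun a => hJI (Finset.orderEmbOfFin_mem _ _ _)
  have hwd0 : ∀ x : Fin 3 → k, x ≠ 0 → wd (S.mulVec x) (T.mulVec x) ≠ 0 := by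
    intro x hx h
    apply hsq0 x hx
    rw [← hH, h, map_zero]
  by_cases hTw : ∃ a b, P = ![a ^ 3, a ^ 2 * b, a * b ^ 2, b ^ 3]
  · obtain ⟨a, b, hab⟩ := hTw
    have key : ∀ m, ∑ i, ![a ^ 4, a ^ 3 * b, a ^ 2 * b ^ 2, a * b ^ 3, b ^ 4] i *
        S.mulVec (w (e m)) i = 0 ∧ ∑ i, ![a ^ 4, a ^ 3 * b, a ^ 2 * b ^ 2, a * b ^ 3, b ^ 4] i *
        T.mulVec (w (e m)) i = 0 := by
      intro m
      have hp := hPu (e m) (heI m)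
      rw [hab] at hp
      simp [Fin.sum_univ_four] at hp
      refine wd_contract _ _ _ _ _ (heq (e m)) ?_ ?_ (hwd0 _ (hw0 _))
      · rw [SA_mulVec]
        simp [Fin.sum_univ_five]
        linear_combination a * hp
      · rw [TA_mulVec]
        simp [Fin.sum_univ_five]
        linear_combination b * hp
    refine hdisj a b ?_ (w (e 0)) (w (e 1)) (hw _ _ ?_) _ rfl (key 0).1 (key 0).2 (key 1).1
      (key 1).2
    · rintro ⟨rfl, rfl⟩
      apply hP0
      rw [hab]
      funext i
      fin_cases i <;> simp
    · intro h
      exact absurd (he h) (by decide)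
  · obtain ⟨Q, hPQ, hgood⟩ := goodP_all P hTw
    -- linear forms
    let F : (Fin 6 → k) →ₗ[k] Matrix (Fin 4) (Fin 4) k := hA ∘ₗ (LL S T) ∘ₗ L6
    have hF : ∀ x, F (s6 x) = hA (wd (S.mulVec x) (T.mulVec x)) := by
      intro x
      simp only [F, LinearMap.comp_apply, L6_s6, LL_sqm]
    have hFw : ∀ i, F (s6 (w i)) = sqm (u i) := by
      intro i
      rw [hF, ← heq, hA_wd]
    let col : (Fin 4 → k) → Fin 4 → Matrix (Fin 4) (Fin 4) k →ₗ[k] k := fun R j =>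
      { toFun := fun X => ∑ a, R a * X a j
        map_add' := by
          intro X Y
          simp only [Matrix.add_apply, mul_add, Finset.sum_add_distrib]
        map_smul' := by
          intro r X
          simp only [Matrix.smul_apply, smul_eq_mul, RingHom.id_apply, Finset.mul_sum]
          apply Finset.sum_congr rfl
          intros; ring }
    let l : Fin 4 → (Fin 6 → k) →ₗ[k] k := fun j => col P j ∘ₗ F
    have hl : ∀ j i, i ∈ I → l j (s6 (w i)) = 0 := by
      intro j i hi
      have := hPu i hi
      simp only [l, LinearMap.comp_apply, hFw]
      change ∑ a, P a * (u i a * u i j) = 0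
      rw [← zero_mul (u i j), ← this, Finset.sum_mul]
      apply Finset.sum_congr rfl
      intros; ring
    have hli : LinearIndependent k (fun a : Fin 5 => s6 (w (e a.castSucc))) := by
      rw [Fintype.linearIndependent_iff]
      intro g hg i
      have := hsmall 5 (fun a => e a.castSucc) le_rfl
        (he.comp (Fin.castSucc_injective 5)) g (by
          have := congrArg L6 hg
          simpa only [map_sum, map_smul, L6_s6, map_zero] using this)
      rw [this]; rfl
    obtain ⟨lam, hlam, hlamw⟩ : ∃ lam : (Fin 6 → k) →ₗ[k] k,
        (∀ x, lam x = 0 → ∀ j, l j x = 0) ∧ ∀ i ∈ I, lam (s6 (w i)) = 0 := by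
      by_cases hz : ∃ j, l j ≠ 0
      · obtain ⟨j0, hj0⟩ := hz
        refine ⟨l j0, ?_, fun i hi => hl j0 i hi⟩
        intro x hx j
        obtain ⟨r, hr⟩ := prop_of_ker hli (l j0) (l j) hj0 (fun a => hl _ _ (heI _))
          (fun a => hl _ _ (heI _))
        rw [hr, LinearMap.smul_apply, hx, smul_zero]
      · push Not at hz
        refine ⟨0, fun x _ j => by rw [hz]; rfl, fun i _ => rfl⟩
    have hQu : ∀ i ∈ I, ∑ a, Q a * u i a = 0 := by
      intro i hi
      by_contra hne
      obtain ⟨x0, x1, x2, r, hr, hx0, hcv, hind⟩ := exists_curve lam (w i) (hw0 i) (hlamw i hi)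
      have hui : ∃ j, u i j ≠ 0 := by
        by_contra! hh
        apply hne
        simp [hh]
      obtain ⟨j, hj⟩ := hui
      obtain ⟨p, hp⟩ := poly_curve (col Q j ∘ₗ F) x0 x1 x2
      let cv : k → Fin 3 → k := fun t => x0 + t • x1 + t ^ 2 • x2
      have hp0 : p ≠ 0 := by
        intro hpz
        have := hp 0
        rw [hpz] at this
        simp only [Polynomial.eval_zero, zero_smul, add_zero, ne_eq, OfNat.ofNat_ne_zero,
          not_false_eq_true, zero_pow] at this
        have e1 : s6 x0 = r ^ 2 • s6 (w i) := by
          rw [hx0]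
          funext a
          fin_cases a <;> simp [s6] <;> ring
        rw [e1, map_smul, LinearMap.comp_apply, hFw] at this
        change 0 = r ^ 2 * ∑ a, Q a * (u i a * u i j) at this
        have e2 : ∑ a, Q a * (u i a * u i j) = (∑ a, Q a * u i a) * u i j := by
          rw [Finset.sum_mul]
          apply Finset.sum_congr rfl
          intros; ring
        rw [e2] at this
        exact mul_ne_zero (pow_ne_zero 2 hr) (mul_ne_zero hne hj) this.symm
      have hDinf : {t : k | t ≠ 0 ∧ p.eval t ≠ 0}.Infinite := by
        have hpx : (p * Polynomial.X) ≠ 0 := mul_ne_zero hp0 Polynomial.X_ne_zero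
        have hfin : {t : k | (p * Polynomial.X).IsRoot t}.Finite :=
          Polynomial.finite_setOfPred_isRoot hpx
        refine (hfin.infinite_compl).mono ?_
        intro t ht
        simp only [Set.mem_compl_iff, Set.mem_ofPred_eq, Polynomial.IsRoot, Polynomial.eval_mul,
          Polynomial.eval_X, mul_eq_zero, not_or] at ht
        exact ⟨ht.2, ht.1⟩
      obtain ⟨t, ht, t', ht', htt, a, b, hab, hz⟩ := hfin _ hDinf cv (by
        intro t ht
        have hcvne : cv t ≠ 0 := by
          intro h0
          apply ht.2
          rw [hp]
          change (col Q j ∘ₗ F) (s6 (cv t)) = 0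
          rw [h0]
          have : s6 (0 : Fin 3 → k) = 0 := by
            funext a
            fin_cases a <;> simp [s6]
          rw [this, map_zero]
        refine ⟨hcvne, ?_⟩
        have h1 : ∀ j, ∑ a, P a * F (s6 (cv t)) a j = 0 := fun j => hlam _ (hcv t) j
        rcases hgood (F (s6 (cv t))) (by rw [hF]; exact hA_symm _ _) (by rw [hF]; exact hA_pl _ _) h1
          with h2 | ⟨f, hf⟩
        · exfalso
          apply ht.2
          rw [hp]
          exact h2 j
        · refine ⟨f, ?_⟩
          have h3 : F (s6 (cv t)) = sqm f := by
            ext a b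
            rw [hf]; rfl
          rw [← LL_sqm, ← h3, hF, LL_hA])
      exact hab (hind t t' ht.1 ht'.1 htt a b hz)
    let e4 : Fin 4 → Fin 7 := fun a => e (Fin.castLE (by norm_num) a)
    have he4 : Function.Injective e4 := he.comp (Fin.castLE_injective _)
    obtain ⟨g, hg0, hg⟩ := pq_dep P Q hPQ (fun m => u (e4 m)) (fun m => hPu _ (heI _))
      (fun m => hQu _ (heI _))
    apply hg0
    apply hsmall 4 e4 (by norm_num) he4 g
    have := hrel' (Function.extend e4 g 0) (by
      rw [extend_sum e4 he4 g (fun i => sqm (u i))]; exact hg)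
    rwa [extend_sum e4 he4 g (fun i => sqm (w i))] at this

end PartThree

section PartFour
variable {k : Type*} [Field k]

theorem rank_one_iff {m n : ℕ} (X : Matrix (Fin m) (Fin n) k) :
    X.rank = 1 ↔ X ≠ 0 ∧ ∀ i j a b, X i a * X j b = X i b * X j a := by
  constructor
  · intro h
    refine ⟨fun h0 => by rw [h0, Matrix.rank_zero] at h; exact zero_ne_one h, ?_⟩
    rw [Matrix.rank_eq_finrank_span_row, finrank_eq_one_iff'] at h
    obtain ⟨v, -, hv⟩ := h
    have : ∀ i, ∃ c : k, ∀ a, X i a = c * (v : Fin n → k) a := by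
      intro i
      obtain ⟨c, hc⟩ := hv ⟨X.row i, Submodule.subset_span ⟨i, rfl⟩⟩
      refine ⟨c, fun a => ?_⟩
      have := congrFun (congrArg Subtype.val hc) a
      exact this.symm
    choose c hc using this
    intro i j a b
    simp only [hc]
    ring
  · rintro ⟨h0, h⟩
    obtain ⟨i0, a0, hia⟩ : ∃ i a, X i a ≠ 0 := by
      by_contra! hh
      exact h0 (by ext i a; exact hh i a)
    rw [Matrix.rank_eq_finrank_span_row]
    have : Submodule.span k (Set.range X.row) = Submodule.span k {X.row i0} := by
      apply le_antisymm
      · rw [Submodule.span_le]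
        rintro _ ⟨i, rfl⟩
        rw [SetLike.mem_coe, Submodule.mem_span_singleton]
        refine ⟨X i a0 / X i0 a0, ?_⟩
        funext b
        have := h i i0 a0 b
        simp only [Pi.smul_apply, smul_eq_mul, Matrix.row]
        field_simp
        linear_combination this
      · rw [Submodule.span_singleton_le_iff_mem]
        exact Submodule.subset_span ⟨i0, rfl⟩
    rw [this]
    apply finrank_span_singleton
    intro hz
    exact hia (congrFun hz a0)

/-- transposed action -/
theorem exists_theta (g : (Fin 5 → k) ≃ₗ[k] (Fin 5 → k)) :
    ∃ θ : (Fin 5 → k) ≃ₗ[k] (Fin 5 → k), ∀ x v, ∑ l, g x l * v l = ∑ l, x l * θ v l := by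
  classical
  let f : (Fin 5 → k) →ₗ[k] (Fin 5 → k) :=
    { toFun := fun v i => ∑ l, g (Pi.single i 1) l * v l
      map_add' := by
        intro v w; funext i
        simp only [Pi.add_apply, mul_add, Finset.sum_add_distrib]
      map_smul' := by
        intro r v; funext i
        simp only [Pi.smul_apply, smul_eq_mul, RingHom.id_apply, Finset.mul_sum]
        apply Finset.sum_congr rfl
        intros; ring }
  have hf : ∀ x v, ∑ l, g x l * v l = ∑ l, x l * f v l := by
    intro x v
    have hx : g x = ∑ i, x i • g (Pi.single i 1) := by
      conv_lhs => rw [pi_eq_sum_univ' x]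
      rw [map_sum]
      apply Finset.sum_congr rfl
      intro i _
      rw [map_smul]
    rw [hx]
    simp only [f, LinearMap.coe_mk, AddHom.coe_mk, Finset.sum_apply, Pi.smul_apply, smul_eq_mul,
      Finset.sum_mul, Finset.mul_sum]
    rw [Finset.sum_comm]
    apply Finset.sum_congr rfl
    intro i _
    apply Finset.sum_congr rfl
    intros; ring
  have hinj : Function.Injective f := by
    rw [← LinearMap.ker_eq_bot, LinearMap.ker_eq_bot']
    intro v hv
    funext i
    have := hf (g.symm (Pi.single i 1)) v
    rw [hv] at this
    simpa [Pi.single_apply] using this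
  exact ⟨LinearEquiv.ofInjectiveEndo f hinj, fun x v => by rw [hf]; rfl⟩

theorem factor_pairs {ι : Type*} (α β : ι → Polynomial k)
    (h : ∀ i j, α i * β j = α j * β i) :
    ∃ (p q : Polynomial k) (m : ι → Polynomial k), IsCoprime p q ∧
      (∀ i, α i = p * m i) ∧ ∀ i, β i = q * m i := by
  classical
  by_cases hz : ∀ i, α i = 0 ∧ β i = 0
  · exact ⟨1, 0, 0, isCoprime_one_left, fun i => by simp [hz i], fun i => by simp [hz i]⟩
  push Not at hz
  obtain ⟨j0, hj0⟩ := hz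
  have hne : ¬ (α j0 = 0 ∧ β j0 = 0) := fun hh => hj0 hh.1 hh.2
  obtain ⟨p, q, hpq, e1, e2⟩ : ∃ p q : Polynomial k, IsCoprime p q ∧
      ∃ _ : α j0 = p * EuclideanDomain.gcd (α j0) (β j0),
      β j0 = q * EuclideanDomain.gcd (α j0) (β j0) := by
    obtain ⟨p, hp⟩ := EuclideanDomain.gcd_dvd_left (α j0) (β j0)
    obtain ⟨q, hq⟩ := EuclideanDomain.gcd_dvd_right (α j0) (β j0)
    have hg : EuclideanDomain.gcd (α j0) (β j0) ≠ 0 := by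
      intro h0
      exact hne (EuclideanDomain.gcd_eq_zero_iff.1 h0)
    refine ⟨p, q, ?_, by rw [mul_comm]; exact hp, by rw [mul_comm]; exact hq⟩
    have hb := EuclideanDomain.gcd_eq_gcd_ab (α j0) (β j0)
    refine ⟨EuclideanDomain.gcdA (α j0) (β j0), EuclideanDomain.gcdB (α j0) (β j0), ?_⟩
    apply mul_left_cancel₀ hg
    generalize EuclideanDomain.gcd (α j0) (β j0) = d at *
    generalize EuclideanDomain.gcdA (α j0) (β j0) = x at *
    generalize EuclideanDomain.gcdB (α j0) (β j0) = y at *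
    rw [hp, hq] at hb
    linear_combination -hb
  set d := EuclideanDomain.gcd (α j0) (β j0) with hd
  have hd0 : d ≠ 0 := by
    intro h0
    exact hne (EuclideanDomain.gcd_eq_zero_iff.1 h0)
  have key : ∀ i, α i * q = p * β i := by
    intro i
    apply mul_left_cancel₀ hd0
    have := h i j0
    rw [e1, e2] at this
    linear_combination this
  have hpq' := hpq
  obtain ⟨x, y, hxy⟩ := hpq
  refine ⟨p, q, fun i => x * α i + y * β i, hpq', fun i => ?_, fun i => ?_⟩
  · linear_combination -α i * hxy + y * key i
  · linear_combination -β i * hxy - x * key i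

theorem poly_dep {n d : ℕ} (hd : d < n) (m : Fin n → Polynomial k)
    (hm : ∀ i, ∀ l, d ≤ l → (m i).coeff l = 0) :
    ∃ c : Fin n → k, c ≠ 0 ∧ ∑ i, Polynomial.C (c i) * m i = 0 := by
  have hdep : ¬ LinearIndependent k (fun i => fun l : Fin d => (m i).coeff l) := by
    intro h
    have := h.fintype_card_le_finrank
    simp at this
    omega
  rw [Fintype.not_linearIndependent_iff] at hdep
  obtain ⟨g, hg, i, hi⟩ := hdep
  refine ⟨g, fun h => hi (by rw [h]; rfl), ?_⟩
  ext l
  simp only [Polynomial.finsetSum_coeff, Polynomial.coeff_C_mul, Polynomial.coeff_zero]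
  by_cases hl : d ≤ l
  · apply Finset.sum_eq_zero
    intro j _
    rw [hm j l hl, mul_zero]
  · have := congrFun hg ⟨l, by omega⟩
    simpa using this

theorem mul_coeff_bound {p m : Polynomial k} {a d : ℕ} (hp : p.coeff a ≠ 0)
    (h : ∀ l, a + d ≤ l → (p * m).coeff l = 0) : ∀ l, d ≤ l → m.coeff l = 0 := by
  intro l hl
  by_cases hm : m = 0
  · simp [hm]
  have hp0 : p ≠ 0 := by rintro rfl; simp at hp
  by_contra hne
  have h1 : a ≤ p.natDegree := Polynomial.le_natDegree_of_ne_zero hp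
  have h2 : l ≤ m.natDegree := Polynomial.le_natDegree_of_ne_zero hne
  have h3 := h (p * m).natDegree (by rw [Polynomial.natDegree_mul hp0 hm]; omega)
  rw [Polynomial.coeff_natDegree, Polynomial.leadingCoeff_eq_zero] at h3
  exact mul_ne_zero hp0 hm h3

theorem poly_lin {p : Polynomial k} {d : ℕ} (h : ∀ l, d ≤ l → p.coeff l = 0) :
    p = ∑ i : Fin d, Polynomial.C (p.coeff i) * Polynomial.X ^ (i : ℕ) := by
  ext l
  simp only [Polynomial.finsetSum_coeff, Polynomial.coeff_C_mul, Polynomial.coeff_X_pow]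
  by_cases hl : d ≤ l
  · rw [h l hl]
    symm
    apply Finset.sum_eq_zero
    intro i _
    rw [if_neg (by omega), mul_zero]
  · rw [Finset.sum_eq_single (⟨l, by omega⟩ : Fin d)]
    · simp
    · intro i _ hi
      rw [if_neg, mul_zero]
      intro h'
      exact hi (Fin.ext h'.symm)
    · simp

end PartFour

section PartFive
variable {k : Type*} [Field k]
open Polynomial

noncomputable def polyN {n : ℕ} (v : Fin n → k) : Polynomial k := ∑ i : Fin n, C (v i) * X ^ (i : ℕ)

theorem polyN_coeff {n : ℕ} (v : Fin n → k) (i : Fin n) : (polyN v).coeff i = v i := by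
  simp only [polyN, Polynomial.finsetSum_coeff, Polynomial.coeff_C_mul, Polynomial.coeff_X_pow]
  rw [Finset.sum_eq_single i]
  · simp
  · intro j _ hj
    rw [if_neg, mul_zero]
    intro h; exact hj (Fin.ext h.symm)
  · simp

theorem polyN_coeff_ge {n : ℕ} (v : Fin n → k) (l : ℕ) (hl : n ≤ l) : (polyN v).coeff l = 0 := by
  simp only [polyN, Polynomial.finsetSum_coeff, Polynomial.coeff_C_mul, Polynomial.coeff_X_pow]
  apply Finset.sum_eq_zero
  intro i _
  rw [if_neg (by omega), mul_zero]

theorem polyN_eval {n : ℕ} (v : Fin n → k) (t : k) :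
    (polyN v).eval t = ∑ i : Fin n, v i * t ^ (i : ℕ) := by
  simp [polyN, Polynomial.eval_finsetSum]

theorem lin_mul_succ (a b : k) (m : Polynomial k) (n : ℕ) :
    ((C a + C b * X) * m).coeff (n + 1) = a * m.coeff (n + 1) + b * m.coeff n := by
  rw [add_mul, mul_assoc, coeff_add, coeff_C_mul, coeff_C_mul, coeff_X_mul]

theorem lin_mul_zero (a b : k) (m : Polynomial k) :
    ((C a + C b * X) * m).coeff 0 = a * m.coeff 0 := by
  simp [mul_coeff_zero]

theorem lin_of_coeff {p : Polynomial k} (h : ∀ l, 2 ≤ l → p.coeff l = 0) :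
    p = C (p.coeff 0) + C (p.coeff 1) * X := by
  conv_lhs => rw [poly_lin h]
  simp [Fin.sum_univ_two]

/-- from `C r * p + C s * q = 0 → r = s = 0` and degree at most one, the determinant is nonzero -/
theorem det_of_nd {p q : Polynomial k} (hp : ∀ l, 2 ≤ l → p.coeff l = 0)
    (hq : ∀ l, 2 ≤ l → q.coeff l = 0)
    (hnd : ∀ r s : k, C r * p + C s * q = 0 → r = 0 ∧ s = 0) :
    p.coeff 0 * q.coeff 1 - p.coeff 1 * q.coeff 0 ≠ 0 := by
  intro hdet
  have ep := lin_of_coeff hp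
  have eq := lin_of_coeff hq
  have h1 := hnd (q.coeff 0) (- p.coeff 0) (by
    rw [ep, eq]
    simp only [coeff_add, coeff_C_zero, coeff_mul_X_zero, add_zero]
    have : (C (p.coeff 0 * q.coeff 1 - p.coeff 1 * q.coeff 0) : Polynomial k) = 0 := by
      rw [hdet, C_0]
    simp only [C_sub, C_mul] at this
    simp only [C_neg]
    linear_combination -X * this)
  have h2 := hnd (q.coeff 1) (- p.coeff 1) (by
    rw [ep, eq]
    have : (C (p.coeff 0 * q.coeff 1 - p.coeff 1 * q.coeff 0) : Polynomial k) = 0 := by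
      rw [hdet, C_0]
    simp [coeff_C] at this ⊢
    linear_combination this)
  have h3 := hnd 1 0 (by
    rw [ep, neg_eq_zero.1 h1.2, neg_eq_zero.1 h2.2]; simp)
  exact one_ne_zero h3.1

theorem lead_of_nd {p q : Polynomial k} (hp : ∀ l, 2 ≤ l → p.coeff l = 0)
    (hq : ∀ l, 2 ≤ l → q.coeff l = 0)
    (hnd : ∀ r s : k, C r * p + C s * q = 0 → r = 0 ∧ s = 0) :
    p.coeff 1 ≠ 0 ∨ q.coeff 1 ≠ 0 := by
  by_contra! h
  apply det_of_nd hp hq hnd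
  rw [h.1, h.2]; ring

theorem normalA [Infinite k] (a : Fin 2 → Fin 4 → Fin 5 → k)
    (hcone : ∀ t : k, ∀ i j, (∑ l : Fin 5, a 0 i l * t ^ (l : ℕ)) * (∑ l, a 1 j l * t ^ (l : ℕ)) =
      (∑ l : Fin 5, a 0 j l * t ^ (l : ℕ)) * (∑ l : Fin 5, a 1 i l * t ^ (l : ℕ)))
    (hnd : ∀ r s : k, (∀ j l, r * a 0 j l + s * a 1 j l = 0) → r = 0 ∧ s = 0)
    (hind : ∀ c : Fin 4 → k, (∀ r l, ∑ j, c j * a r j l = 0) → c = 0) :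
    ∃ g00 g01 g10 g11 : k, g00 * g11 - g01 * g10 ≠ 0 ∧ ∃ f : Fin 4 → Fin 4 → k, ∀ j,
      a 0 j = g00 • SA.mulVec (f j) + g01 • TA.mulVec (f j) ∧
      a 1 j = g10 • SA.mulVec (f j) + g11 • TA.mulVec (f j) := by
  obtain ⟨p, q, m, hpq, hα, hβ⟩ := factor_pairs (fun j => polyN (a 0 j)) (fun j => polyN (a 1 j)) (by
    intro i j
    apply Polynomial.funext
    intro t
    rw [eval_mul, eval_mul, polyN_eval, polyN_eval, polyN_eval, polyN_eval]
    exact hcone t i j)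
  have hndp : ∀ r s : k, C r * p + C s * q = 0 → r = 0 ∧ s = 0 := by
    intro r s h
    apply hnd
    intro j l
    rw [← polyN_coeff (a 0 j) l, ← polyN_coeff (a 1 j) l, ← coeff_C_mul, ← coeff_C_mul, ← coeff_add,
      hα, hβ]
    have : C r * (p * m j) + C s * (q * m j) = 0 := by linear_combination m j * h
    rw [this, coeff_zero]
  have hdep : ∀ c : Fin 4 → k, ∑ j, C (c j) * m j = 0 → c = 0 := by
    intro c hc
    apply hind
    intro r l
    have key : ∀ x : Polynomial k, ∑ j, C (c j) * (x * m j) = 0 := by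
      intro x
      rw [← mul_zero x, ← hc, Finset.mul_sum]
      apply Finset.sum_congr rfl
      intros; ring
    have e0 := congrArg (fun z => z.coeff (l : ℕ)) (key p)
    have e1 := congrArg (fun z => z.coeff (l : ℕ)) (key q)
    simp only [← hα, ← hβ, finsetSum_coeff, coeff_C_mul, polyN_coeff, coeff_zero] at e0 e1
    fin_cases r
    · exact e0
    · exact e1
  have hp2 : ∀ l, 2 ≤ l → p.coeff l = 0 := by
    intro l hl
    by_contra hne
    obtain ⟨c, hc0, hc⟩ := poly_dep (d := 3) (n := 4) (by norm_num) m (fun i =>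
      mul_coeff_bound hne (fun l' hl' => by
        rw [← hα]; exact polyN_coeff_ge _ _ (by omega)))
    exact hc0 (hdep c hc)
  have hq2 : ∀ l, 2 ≤ l → q.coeff l = 0 := by
    intro l hl
    by_contra hne
    obtain ⟨c, hc0, hc⟩ := poly_dep (d := 3) (n := 4) (by norm_num) m (fun i =>
      mul_coeff_bound hne (fun l' hl' => by
        rw [← hβ]; exact polyN_coeff_ge _ _ (by omega)))
    exact hc0 (hdep c hc)
  have hm4 : ∀ j l, 4 ≤ l → (m j).coeff l = 0 := by
    intro j
    rcases lead_of_nd hp2 hq2 hndp with h | h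
    · exact mul_coeff_bound h (fun l' hl' => by rw [← hα]; exact polyN_coeff_ge _ _ (by omega))
    · exact mul_coeff_bound h (fun l' hl' => by rw [← hβ]; exact polyN_coeff_ge _ _ (by omega))
  have fin : ∀ (v : Fin 5 → k) (p m : Polynomial k), (∀ l, 2 ≤ l → p.coeff l = 0) →
      (∀ l, 4 ≤ l → m.coeff l = 0) → polyN v = p * m →
      v = p.coeff 0 • SA.mulVec (fun i : Fin 4 => m.coeff i) +
        p.coeff 1 • TA.mulVec (fun i : Fin 4 => m.coeff i) := by
    intro v p m hp hm h
    rw [lin_of_coeff hp] at h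
    rw [SA_mulVec, TA_mulVec]
    have e0 := polyN_coeff v 0
    have e1 := polyN_coeff v 1
    have e2 := polyN_coeff v 2
    have e3 := polyN_coeff v 3
    have e4 := polyN_coeff v 4
    rw [h] at e0 e1 e2 e3 e4
    have z4 := hm 4 le_rfl
    change coeff _ 0 = _ at e0
    change coeff _ (0 + 1) = _ at e1
    change coeff _ (1 + 1) = _ at e2
    change coeff _ (2 + 1) = _ at e3
    change coeff _ (3 + 1) = _ at e4
    rw [lin_mul_zero] at e0
    rw [lin_mul_succ] at e1 e2 e3 e4
    funext i
    fin_cases i <;> simp [← e0, ← e1, ← e2, ← e3, ← e4, z4]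
  exact ⟨p.coeff 0, p.coeff 1, q.coeff 0, q.coeff 1, det_of_nd hp2 hq2 hndp,
    fun j i => (m j).coeff i, fun j => ⟨fin _ _ _ hp2 (hm4 j) (hα j), fin _ _ _ hq2 (hm4 j) (hβ j)⟩⟩

/-- the two polynomial parts of a vector, for the scroll -/
noncomputable def pL (v : Fin 5 → k) : Polynomial k := polyN ![v 0, v 1]
noncomputable def pM (v : Fin 5 → k) : Polynomial k := polyN ![v 2, v 3, v 4]

theorem pL_eval (v : Fin 5 → k) (t : k) : (pL v).eval t = v 0 + v 1 * t := by
  simp [pL, polyN_eval, Fin.sum_univ_two]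
theorem pM_eval (v : Fin 5 → k) (t : k) : (pM v).eval t = v 2 + v 3 * t + v 4 * t ^ 2 := by
  simp [pM, polyN_eval, Fin.sum_univ_three]
theorem pL_ge (v : Fin 5 → k) (l : ℕ) (hl : 2 ≤ l) : (pL v).coeff l = 0 := polyN_coeff_ge _ _ hl
theorem pM_ge (v : Fin 5 → k) (l : ℕ) (hl : 3 ≤ l) : (pM v).coeff l = 0 := polyN_coeff_ge _ _ hl
theorem pL_0 (v : Fin 5 → k) : (pL v).coeff 0 = v 0 := polyN_coeff ![v 0, v 1] 0
theorem pL_1 (v : Fin 5 → k) : (pL v).coeff 1 = v 1 := polyN_coeff ![v 0, v 1] 1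
theorem pM_0 (v : Fin 5 → k) : (pM v).coeff 0 = v 2 := polyN_coeff ![v 2, v 3, v 4] 0
theorem pM_1 (v : Fin 5 → k) : (pM v).coeff 1 = v 3 := polyN_coeff ![v 2, v 3, v 4] 1
theorem pM_2 (v : Fin 5 → k) : (pM v).coeff 2 = v 4 := polyN_coeff ![v 2, v 3, v 4] 2

theorem fin5_of_pLM {P : Fin 5 → Prop} (h0 : P 0) (h1 : P 1) (h2 : P 2) (h3 : P 3) (h4 : P 4) :
    ∀ i, P i := by
  intro i; fin_cases i <;> assumption

theorem normalB [Infinite k] (b : Fin 3 → Fin 2 → Fin 5 → k)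
    (hcone : ∀ x y t : k, ∀ i j,
      (x * (b i 0 0 + b i 0 1 * t) + y * (b i 0 2 + b i 0 3 * t + b i 0 4 * t ^ 2)) *
      (x * (b j 1 0 + b j 1 1 * t) + y * (b j 1 2 + b j 1 3 * t + b j 1 4 * t ^ 2)) =
      (x * (b j 0 0 + b j 0 1 * t) + y * (b j 0 2 + b j 0 3 * t + b j 0 4 * t ^ 2)) *
      (x * (b i 1 0 + b i 1 1 * t) + y * (b i 1 2 + b i 1 3 * t + b i 1 4 * t ^ 2)))
    (hnd : ∀ r s : k, (∀ i l, r * b i 0 l + s * b i 1 l = 0) → r = 0 ∧ s = 0)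
    (hind : ∀ c : Fin 3 → k, (∀ r l, ∑ i, c i * b i r l = 0) → c = 0) :
    ∃ g00 g01 g10 g11 : k, g00 * g11 - g01 * g10 ≠ 0 ∧ ∃ f : Fin 3 → Fin 3 → k, ∀ i,
      b i 0 = g00 • SB.mulVec (f i) + g01 • TB.mulVec (f i) ∧
      b i 1 = g10 • SB.mulVec (f i) + g11 • TB.mulVec (f i) := by
  have hLL : ∀ i j, pL (b i 0) * pL (b j 1) = pL (b j 0) * pL (b i 1) := by
    intro i j
    apply Polynomial.funext
    intro t
    simp only [eval_mul, pL_eval]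
    linear_combination hcone 1 0 t i j
  have hMM : ∀ i j, pM (b i 0) * pM (b j 1) = pM (b j 0) * pM (b i 1) := by
    intro i j
    apply Polynomial.funext
    intro t
    simp only [eval_mul, pM_eval]
    linear_combination hcone 0 1 t i j
  have hLM : ∀ i j, pL (b i 0) * pM (b j 1) + pM (b i 0) * pL (b j 1) =
      pL (b j 0) * pM (b i 1) + pM (b j 0) * pL (b i 1) := by
    intro i j
    apply Polynomial.funext
    intro t
    simp only [eval_mul, eval_add, pM_eval, pL_eval]
    linear_combination hcone 1 1 t i j - hcone 1 0 t i j - hcone 0 1 t i j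
  have hndp : ∀ r s : k, (∀ i, C r * pL (b i 0) + C s * pL (b i 1) = 0) →
      (∀ i, C r * pM (b i 0) + C s * pM (b i 1) = 0) → r = 0 ∧ s = 0 := by
    intro r s h1 h2
    apply hnd
    intro i
    have c1 := fun n : ℕ => congrArg (fun z => coeff z n) (h1 i)
    have c2 := fun n : ℕ => congrArg (fun z => coeff z n) (h2 i)
    simp only [coeff_add, coeff_C_mul, coeff_zero] at c1 c2
    apply fin5_of_pLM
    · simpa only [pL_0] using c1 0
    · simpa only [pL_1] using c1 1
    · simpa only [pM_0] using c2 0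
    · simpa only [pM_1] using c2 1
    · simpa only [pM_2] using c2 2
  have hindp : ∀ c : Fin 3 → k, (∀ r, ∑ i, C (c i) * pL (b i r) = 0) →
      (∀ r, ∑ i, C (c i) * pM (b i r) = 0) → c = 0 := by
    intro c h1 h2
    apply hind
    intro r
    have c1 := fun n : ℕ => congrArg (fun z => coeff z n) (h1 r)
    have c2 := fun n : ℕ => congrArg (fun z => coeff z n) (h2 r)
    simp only [finsetSum_coeff, coeff_C_mul, coeff_zero] at c1 c2
    apply fin5_of_pLM
    · simpa only [pL_0] using c1 0
    · simpa only [pL_1] using c1 1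
    · simpa only [pM_0] using c2 0
    · simpa only [pM_1] using c2 1
    · simpa only [pM_2] using c2 2
  -- second type: common column vector (p, q)
  have type2 : ∀ (p q : Polynomial k) (l m : Fin 3 → Polynomial k),
      (∀ i, pL (b i 0) = p * l i) → (∀ i, pL (b i 1) = q * l i) →
      (∀ i, pM (b i 0) = p * m i) → (∀ i, pM (b i 1) = q * m i) →
      ∃ g00 g01 g10 g11 : k, g00 * g11 - g01 * g10 ≠ 0 ∧ ∃ f : Fin 3 → Fin 3 → k, ∀ i,
        b i 0 = g00 • SB.mulVec (f i) + g01 • TB.mulVec (f i) ∧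
        b i 1 = g10 • SB.mulVec (f i) + g11 • TB.mulVec (f i) := by
    intro p q l m hl0 hl1 hm0 hm1
    have hnd2 : ∀ r s : k, C r * p + C s * q = 0 → r = 0 ∧ s = 0 := by
      intro r s h
      apply hndp
      · intro i; rw [hl0, hl1]; linear_combination l i * h
      · intro i; rw [hm0, hm1]; linear_combination m i * h
    have hdep : ∀ c : Fin 3 → k, ∑ j, C (c j) * l j = 0 → ∑ j, C (c j) * m j = 0 → c = 0 := by
      intro c h1 h2
      have key : ∀ (x : Polynomial k) (m : Fin 3 → Polynomial k), ∑ j, C (c j) * m j = 0 →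
          ∑ j, C (c j) * (x * m j) = 0 := by
        intro x m hc
        rw [← mul_zero x, ← hc, Finset.mul_sum]
        apply Finset.sum_congr rfl
        intros; ring
      apply hindp
      · intro r
        fin_cases r
        · simp only [Fin.zero_eta, hl0]; exact key p l h1
        · simp only [Fin.mk_one, hl1]; exact key q l h1
      · intro r
        fin_cases r
        · simp only [Fin.zero_eta, hm0]; exact key p m h2
        · simp only [Fin.mk_one, hm1]; exact key q m h2
    have nodeg : ∀ p : Polynomial k, (∀ i n, 2 ≤ n → (p * l i).coeff n = 0) →
        (∀ i n, 3 ≤ n → (p * m i).coeff n = 0) → ∀ n, 2 ≤ n → p.coeff n = 0 := by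
      intro p h1 h2 n hn
      by_contra hne
      have l0 : ∀ i, l i = 0 := by
        intro i
        ext n'
        exact mul_coeff_bound (d := 0) hne (fun l' hl' => h1 i l' (by omega)) n' (Nat.zero_le _)
      obtain ⟨c, hc0, hc⟩ := poly_dep (d := 1) (n := 3) (by norm_num) m (fun i =>
        mul_coeff_bound hne (fun l' hl' => h2 i l' (by omega)))
      exact hc0 (hdep c (by simp [l0]) hc)
    have hp2 := nodeg p (fun i n hn => by rw [← hl0]; exact pL_ge _ _ hn)
      (fun i n hn => by rw [← hm0]; exact pM_ge _ _ hn)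
    have hq2 := nodeg q (fun i n hn => by rw [← hl1]; exact pL_ge _ _ hn)
      (fun i n hn => by rw [← hm1]; exact pM_ge _ _ hn)
    have hbd : (∀ j n, 1 ≤ n → (l j).coeff n = 0) ∧ (∀ j n, 2 ≤ n → (m j).coeff n = 0) := by
      rcases lead_of_nd hp2 hq2 hnd2 with h | h
      · exact ⟨fun j => mul_coeff_bound h (fun l' hl' => by rw [← hl0]; exact pL_ge _ _ (by omega)),
          fun j => mul_coeff_bound h (fun l' hl' => by rw [← hm0]; exact pM_ge _ _ (by omega))⟩
      · exact ⟨fun j => mul_coeff_bound h (fun l' hl' => by rw [← hl1]; exact pL_ge _ _ (by omega)),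
          fun j => mul_coeff_bound h (fun l' hl' => by rw [← hm1]; exact pM_ge _ _ (by omega))⟩
    have fin : ∀ (v : Fin 5 → k) (p l m : Polynomial k), (∀ n, 2 ≤ n → p.coeff n = 0) →
        (∀ n, 1 ≤ n → l.coeff n = 0) → (∀ n, 2 ≤ n → m.coeff n = 0) →
        pL v = p * l → pM v = p * m →
        v = p.coeff 0 • SB.mulVec ![l.coeff 0, m.coeff 0, m.coeff 1] +
          p.coeff 1 • TB.mulVec ![l.coeff 0, m.coeff 0, m.coeff 1] := by
      intro v p l m hp hl hm h1 h2
      rw [lin_of_coeff hp] at h1 h2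
      rw [SB_mulVec, TB_mulVec]
      have e0 := pL_0 v
      have e1 := pL_1 v
      have e2 := pM_0 v
      have e3 := pM_1 v
      have e4 := pM_2 v
      rw [h1] at e0 e1
      rw [h2] at e2 e3 e4
      have z1 := hl 1 le_rfl
      have z2 := hm 2 le_rfl
      rw [lin_mul_zero] at e0 e2
      change coeff _ (0 + 1) = _ at e1
      change coeff _ (0 + 1) = _ at e3
      change coeff _ (1 + 1) = _ at e4
      rw [lin_mul_succ] at e1 e3 e4
      funext i
      fin_cases i <;> simp [← e0, ← e1, ← e2, ← e3, ← e4, z1, z2]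
    exact ⟨p.coeff 0, p.coeff 1, q.coeff 0, q.coeff 1, det_of_nd hp2 hq2 hnd2,
      fun j => ![(l j).coeff 0, (m j).coeff 0, (m j).coeff 1], fun j =>
      ⟨fin _ _ _ _ hp2 (hbd.1 j) (hbd.2 j) (hl0 j) (hm0 j),
        fin _ _ _ _ hq2 (hbd.1 j) (hbd.2 j) (hl1 j) (hm1 j)⟩⟩
  obtain ⟨p, q, m, hpq, hm0, hm1⟩ := factor_pairs (fun i => pM (b i 0)) (fun i => pM (b i 1)) hMM
  obtain ⟨p', q', l, hpq', hl0, hl1⟩ := factor_pairs (fun i => pL (b i 0)) (fun i => pL (b i 1)) hLL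
  have hprod : ∀ i j, (p' * q - p * q') * (l i * m j - l j * m i) = 0 := by
    intro i j
    have := hLM i j
    simp only [hm0, hm1, hl0, hl1] at this
    linear_combination this
  by_cases hpp : p' * q - p * q' = 0
  · -- proportional
    obtain ⟨x, y, hxy⟩ := hpq
    refine type2 p q (fun i => (x * p' + y * q') * l i) m ?_ ?_ hm0 hm1
    · intro i
      rw [hl0]
      linear_combination -p' * l i * hxy + y * l i * hpp
    · intro i
      rw [hl1]
      linear_combination -q' * l i * hxy - x * l i * hpp
  · exfalso
    obtain ⟨c, d, n, -, hln, hmn⟩ := factor_pairs l m (by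
      intro i j
      have := (mul_eq_zero.1 (hprod i j)).resolve_left hpp
      linear_combination this)
    have hL0 : ∀ i, pL (b i 0) = (p' * c) * n i := fun i => by rw [hl0, hln]; ring
    have hL1 : ∀ i, pL (b i 1) = (q' * c) * n i := fun i => by rw [hl1, hln]; ring
    have hM0 : ∀ i, pM (b i 0) = (p * d) * n i := fun i => by rw [hm0, hmn]; ring
    have hM1 : ∀ i, pM (b i 1) = (q * d) * n i := fun i => by rw [hm1, hmn]; ring
    obtain ⟨i, e, he, hne⟩ : ∃ i e, 2 ≤ e ∧ (n i).coeff e ≠ 0 := by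
      by_contra! hcon
      obtain ⟨g, hg0, hg⟩ := poly_dep (d := 2) (n := 3) (by norm_num) n hcon
      have key : ∀ (x : Polynomial k), ∑ j, C (g j) * (x * n j) = 0 := by
        intro x
        rw [← mul_zero x, ← hg, Finset.mul_sum]
        apply Finset.sum_congr rfl
        intros; ring
      apply hg0
      apply hindp
      · intro r
        fin_cases r
        · simp only [Fin.zero_eta, hL0]; exact key _
        · simp only [Fin.mk_one, hL1]; exact key _
      · intro r
        fin_cases r
        · simp only [Fin.zero_eta, hM0]; exact key _
        · simp only [Fin.mk_one, hM1]; exact key _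
    have hz : ∀ x : Polynomial k, (∀ n', 2 ≤ n' → (x * n i).coeff n' = 0) → x = 0 := by
      intro x hx
      ext n'
      exact mul_coeff_bound (d := 0) hne (fun l' hl' => by
        rw [mul_comm]; exact hx l' (by omega)) n' (Nat.zero_le _)
    have hc : ∀ x : Polynomial k, (∀ n', 3 ≤ n' → (x * n i).coeff n' = 0) → x = C (x.coeff 0) := by
      intro x hx
      have := mul_coeff_bound (d := 1) (m := x) hne (fun l' hl' => by
        rw [mul_comm]; exact hx l' (by omega))
      conv_lhs => rw [poly_lin this]
      simp
    have z0 := hz _ (fun n' h' => by rw [← hL0]; exact pL_ge _ _ h')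
    have z1 := hz _ (fun n' h' => by rw [← hL1]; exact pL_ge _ _ h')
    have c0 := hc _ (fun n' h' => by rw [← hM0]; exact pM_ge _ _ h')
    have c1 := hc _ (fun n' h' => by rw [← hM1]; exact pM_ge _ _ h')
    generalize (p * d).coeff 0 = P0 at c0
    generalize (q * d).coeff 0 = Q0 at c1
    have h1 := hndp Q0 (-P0) (fun i => by rw [hL0, hL1, z0, z1]; simp) (fun i => by
      rw [hM0, hM1, c0, c1, C_neg]; ring)
    have h2 := hndp 1 0 (fun i => by rw [hL0, z0]; simp) (fun i => by
      rw [hM0, c0, neg_eq_zero.1 h1.2]; simp)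
    exact one_ne_zero h2.1

end PartFive

section PartSix
variable {k : Type*} [Field k]

theorem nondeg {m n : ℕ} (D : Matrix (Fin m) (Fin n) (Fin 5 → k)) (K : Set (Fin 5 → k))
    (hK : ∀ x, x ∉ K → x ∉ rankOneLocus D) (c : Fin 5) (hc : (Pi.single c 1 : Fin 5 → k) ∉ K)
    (hci : ∀ i, i ≠ c → (Pi.single c 1 + Pi.single i 1 : Fin 5 → k) ∉ K)
    (hmin : ∀ (x : Fin 5 → k) i j a b, (∑ l, x l * D i a l) * (∑ l, x l * D j b l) =
      (∑ l, x l * D i b l) * (∑ l, x l * D j a l)) : ∀ i a l, D i a l = 0 := by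
  have key : ∀ x, x ∉ K → ∀ i a, ∑ l, x l * D i a l = 0 := by
    intro x hx i a
    by_contra hne
    apply hK x hx
    change Matrix.rank _ = 1
    rw [rank_one_iff]
    refine ⟨fun h => hne (congrFun (congrFun h i) a), fun i j a b => hmin x i j a b⟩
  intro i a l
  have h0 := key _ hc i a
  simp [Pi.single_apply] at h0
  by_cases hl : l = c
  · rw [hl]; exact h0
  · have h1 := key _ (hci l hl) i a
    simpa [Pi.single_apply, add_mul, Finset.sum_add_distrib, h0] using h1

theorem span_normal {n : ℕ} (S T : Matrix (Fin 5) (Fin n) k)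
    (θ : (Fin 5 → k) ≃ₗ[k] (Fin 5 → k)) (A0 A1 : Fin n → Fin 5 → k)
    (hind : ∀ c : Fin n → k, ∑ j, c j • A0 j = 0 → ∑ j, c j • A1 j = 0 → c = 0)
    (g00 g01 g10 g11 : k) (f : Fin n → Fin n → k)
    (h : ∀ j, θ (A0 j) = g00 • S.mulVec (f j) + g01 • T.mulVec (f j) ∧
      θ (A1 j) = g10 • S.mulVec (f j) + g11 • T.mulVec (f j)) (p : (Fin 5 → k) × (Fin 5 → k)) :
    p ∈ Submodule.span k (Set.range fun j => (A0 j, A1 j)) ↔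
      ∃ u, θ p.1 = g00 • S.mulVec u + g01 • T.mulVec u ∧
        θ p.2 = g10 • S.mulVec u + g11 • T.mulVec u := by
  have comb : ∀ (c : Fin n → k), θ (∑ j, c j • A0 j) =
      g00 • S.mulVec (∑ j, c j • f j) + g01 • T.mulVec (∑ j, c j • f j) ∧
      θ (∑ j, c j • A1 j) =
      g10 • S.mulVec (∑ j, c j • f j) + g11 • T.mulVec (∑ j, c j • f j) := by
    intro c
    simp only [map_sum, map_smul, Matrix.mulVec_sum, Matrix.mulVec_smul, Finset.smul_sum,
      ← Finset.sum_add_distrib, h]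
    constructor
    · apply Finset.sum_congr rfl; intro j _; module
    · apply Finset.sum_congr rfl; intro j _; module
  constructor
  · intro hp
    rw [Submodule.mem_span_range_iff_exists_fun] at hp
    obtain ⟨c, rfl⟩ := hp
    refine ⟨∑ j, c j • f j, ?_⟩
    simpa [Prod.fst_sum, Prod.snd_sum] using comb c
  · rintro ⟨u, h1, h2⟩
    have hli : LinearIndependent k f := by
      rw [Fintype.linearIndependent_iff]
      intro c hc
      have := comb c
      rw [hc] at this
      simp only [Matrix.mulVec_zero, smul_zero, add_zero] at this
      have h0 := hind c (θ.map_eq_zero_iff.1 this.1) (θ.map_eq_zero_iff.1 this.2)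
      intro i; rw [h0]; rfl
    have htop := hli.span_eq_top_of_card_eq_finrank' (by simp)
    have hu : u ∈ Submodule.span k (Set.range f) := by rw [htop]; trivial
    rw [Submodule.mem_span_range_iff_exists_fun] at hu
    obtain ⟨c, rfl⟩ := hu
    rw [Submodule.mem_span_range_iff_exists_fun]
    refine ⟨c, ?_⟩
    ext1
    · simp only [Prod.fst_sum, Prod.smul_fst]
      apply θ.injective
      rw [h1, (comb c).1]
    · simp only [Prod.snd_sum, Prod.smul_snd]
      apply θ.injective
      rw [h2, (comb c).2]

theorem ind_of_finrank {n : ℕ} (A0 A1 : Fin n → Fin 5 → k)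
    (h : Module.finrank k (Submodule.span k (Set.range fun j => (A0 j, A1 j))) = n) :
    ∀ c : Fin n → k, ∑ j, c j • A0 j = 0 → ∑ j, c j • A1 j = 0 → c = 0 := by
  have hli : LinearIndependent k (fun j => (A0 j, A1 j)) := by
    rw [linearIndependent_iff_card_eq_finrank_span]
    simp [Set.finrank, h]
  intro c h0 h1
  rw [Fintype.linearIndependent_iff] at hli
  funext j
  refine hli c ?_ j
  ext1
  · simpa [Prod.fst_sum] using h0
  · simpa [Prod.snd_sum] using h1

theorem locus_theta {m n : ℕ} (A : Matrix (Fin m) (Fin n) (Fin 5 → k))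
    (g θ : (Fin 5 → k) ≃ₗ[k] (Fin 5 → k)) (hθ : ∀ x v, ∑ l, g x l * v l = ∑ l, x l * θ v l)
    (x : Fin 5 → k) : x ∈ rankOneLocus (fun i j => θ (A i j)) ↔ g x ∈ rankOneLocus A := by
  change Matrix.rank _ = 1 ↔ Matrix.rank _ = 1
  simp only [hθ]

theorem notin_theta {m n : ℕ} (A : Matrix (Fin m) (Fin n) (Fin 5 → k)) (K : Set (Fin 5 → k))
    (g θ : (Fin 5 → k) ≃ₗ[k] (Fin 5 → k)) (hθ : ∀ x v, ∑ l, g x l * v l = ∑ l, x l * θ v l)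
    (hg : rankOneLocus A ∪ {0} = g '' K) :
    ∀ x, x ∉ K → x ∉ rankOneLocus (fun i j => θ (A i j)) := by
  intro x hx h
  rw [locus_theta A g θ hθ] at h
  have : g x ∈ g '' K := by rw [← hg]; exact Or.inl h
  obtain ⟨y, hy, hxy⟩ := this
  rw [g.injective hxy] at hy
  exact hx hy

theorem minor_theta {m n : ℕ} (A : Matrix (Fin m) (Fin n) (Fin 5 → k)) (K : Set (Fin 5 → k))
    (g θ : (Fin 5 → k) ≃ₗ[k] (Fin 5 → k)) (hθ : ∀ x v, ∑ l, g x l * v l = ∑ l, x l * θ v l)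
    (hg : rankOneLocus A ∪ {0} = g '' K) (x : Fin 5 → k) (hx : x ∈ K) (i j : Fin m) (a b : Fin n) :
    (∑ l, x l * θ (A i a) l) * (∑ l, x l * θ (A j b) l) =
      (∑ l, x l * θ (A i b) l) * (∑ l, x l * θ (A j a) l) := by
  have : g x ∈ rankOneLocus A ∪ {0} := by rw [hg]; exact ⟨x, hx, rfl⟩
  rcases this with h | h
  · rw [← locus_theta A g θ hθ] at h
    have h' := (rank_one_iff _).1 h
    exact h'.2 i j a b
  · have hx0 : x = 0 := g.map_eq_zero_iff.1 h
    simp [hx0]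

theorem normA_full [IsAlgClosed k] (A₁ : Matrix (Fin 2) (Fin 4) (Fin 5 → k))
    (hCA : IsRNQuartic A₁) (hVA : Module.finrank k (colSpace A₁) = 4) :
    ∃ g θ : (Fin 5 → k) ≃ₗ[k] (Fin 5 → k), (∀ x v, ∑ l, g x l * v l = ∑ l, x l * θ v l) ∧
      (rankOneLocus A₁ ∪ {0} = g '' coneQuartic k) ∧
      ∃ g00 g01 g10 g11 : k, g00 * g11 - g01 * g10 ≠ 0 ∧ ∀ p, p ∈ colSpace A₁ ↔
        ∃ u, θ p.1 = g00 • SA.mulVec u + g01 • TA.mulVec u ∧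
        θ p.2 = g10 • SA.mulVec u + g11 • TA.mulVec u := by
  have : Infinite k := IsAlgClosed.instInfinite
  obtain ⟨g, hg⟩ := hCA
  obtain ⟨θ, hθ⟩ := exists_theta g
  have hind := ind_of_finrank (fun j => A₁ 0 j) (fun j => A₁ 1 j) hVA
  have hind' : ∀ c : Fin 4 → k, (∀ r l, ∑ j, c j * θ (A₁ r j) l = 0) → c = 0 := by
    intro c hc
    apply hind
    · apply θ.injective
      funext l
      simpa [map_sum, map_smul] using hc 0 l
    · apply θ.injective
      funext l
      simpa [map_sum, map_smul] using hc 1 l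
  obtain ⟨g00, g01, g10, g11, hdet, f, hf⟩ := normalA (fun r j => θ (A₁ r j)) (by
    intro t i j
    have := minor_theta A₁ (coneQuartic k) g θ hθ hg ![1, t, t ^ 2, t ^ 3, t ^ 4]
      ⟨1, t, by simp⟩ 0 1 i j
    simp [Fin.sum_univ_five] at this ⊢
    linear_combination this) (by
    intro r s hrs
    by_contra hne
    have hz := nondeg (fun i j => θ (A₁ i j)) (coneQuartic k) (notin_theta A₁ _ g θ hθ hg) 2
      (by
        rintro ⟨s, t, h⟩
        have h1 := congrFun h 1
        have h2 := congrFun h 2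
        have h3 := congrFun h 3
        simp [Pi.single_apply] at h1 h2 h3
        rcases h1 with h1 | h1 <;> simp [h1] at h2)
      (by
        rintro i hi ⟨s, t, h⟩
        have h1 := congrFun h 1
        have h2 := congrFun h 2
        have h3 := congrFun h 3
        fin_cases i <;> simp [Pi.single_apply] at hi h1 h2 h3 <;>
          first
          | (rcases h1 with h1 | h1 <;> simp [h1] at h2)
          | (rcases h3 with h3 | h3 <;> simp [h3] at h2))
      (by
        intro x i j a b
        have hX : ∀ a, r * (∑ l, x l * θ (A₁ 0 a) l) + s * (∑ l, x l * θ (A₁ 1 a) l) = 0 := by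
          intro a
          rw [Finset.mul_sum, Finset.mul_sum, ← Finset.sum_add_distrib]
          apply Finset.sum_eq_zero
          intro l _
          linear_combination x l * hrs a l
        have hm : (∑ l, x l * θ (A₁ 0 a) l) * (∑ l, x l * θ (A₁ 1 b) l) =
            (∑ l, x l * θ (A₁ 0 b) l) * (∑ l, x l * θ (A₁ 1 a) l) := by
          have ha := hX a
          have hb := hX b
          by_cases hr : r = 0
          · have hs : s ≠ 0 := fun h => hne ⟨hr, h⟩
            apply mul_left_cancel₀ hs
            linear_combination (∑ l, x l * θ (A₁ 0 a) l) * hb - (∑ l, x l * θ (A₁ 0 b) l) * ha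
          · apply mul_left_cancel₀ hr
            linear_combination (∑ l, x l * θ (A₁ 1 b) l) * ha - (∑ l, x l * θ (A₁ 1 a) l) * hb
        fin_cases i <;> fin_cases j
        · exact mul_comm _ _
        · exact hm
        · simp only [Fin.mk_one, Fin.zero_eta]; linear_combination -hm
        · exact mul_comm _ _)
    have := hind' 1 (fun r l => by simp [hz r _ l])
    exact one_ne_zero (congrFun this 0)) hind'
  exact ⟨g, θ, hθ, hg, g00, g01, g10, g11, hdet, fun p =>
    span_normal SA TA θ (fun j => A₁ 0 j) (fun j => A₁ 1 j) hind g00 g01 g10 g11 f hf p⟩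

theorem normB_full [IsAlgClosed k] (B₁ : Matrix (Fin 3) (Fin 2) (Fin 5 → k))
    (hSB : IsCubicScroll B₁) (hVB : Module.finrank k (rowSpace B₁) = 3) :
    ∃ θ : (Fin 5 → k) ≃ₗ[k] (Fin 5 → k),
      ∃ g00 g01 g10 g11 : k, g00 * g11 - g01 * g10 ≠ 0 ∧ ∀ p, p ∈ rowSpace B₁ ↔
        ∃ u, θ p.1 = g00 • SB.mulVec u + g01 • TB.mulVec u ∧
        θ p.2 = g10 • SB.mulVec u + g11 • TB.mulVec u := by
  have : Infinite k := IsAlgClosed.instInfinite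
  obtain ⟨g, hg⟩ := hSB
  obtain ⟨θ, hθ⟩ := exists_theta g
  have hind := ind_of_finrank (fun i => B₁ i 0) (fun i => B₁ i 1) hVB
  have hind' : ∀ c : Fin 3 → k, (∀ r l, ∑ j, c j * θ (B₁ j r) l = 0) → c = 0 := by
    intro c hc
    apply hind
    · apply θ.injective
      funext l
      simpa [map_sum, map_smul] using hc 0 l
    · apply θ.injective
      funext l
      simpa [map_sum, map_smul] using hc 1 l
  obtain ⟨g00, g01, g10, g11, hdet, f, hf⟩ := normalB (fun r j => θ (B₁ r j)) (by
    intro x y t i j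
    have := minor_theta B₁ (coneScroll k) g θ hθ hg ![x, x * t, y, y * t, y * t ^ 2]
      ⟨x, y, 1, t, by simp⟩ i j 0 1
    simp [Fin.sum_univ_five] at this ⊢
    linear_combination this) (by
    intro r s hrs
    by_contra hne
    have hz := nondeg (fun i j => θ (B₁ i j)) (coneScroll k) (notin_theta B₁ _ g θ hθ hg) 3
      (by
        rintro ⟨a, b, s, t, h⟩
        have h2 := congrFun h 2
        have h3 := congrFun h 3
        simp [Pi.single_apply] at h2 h3
        rcases h2 with h2 | h2 <;> simp [h2] at h3)
      (by
        rintro i hi ⟨a, b, s, t, h⟩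
        have h2 := congrFun h 2
        have h3 := congrFun h 3
        have h4 := congrFun h 4
        fin_cases i <;> simp [Pi.single_apply] at hi h2 h3 h4 <;>
          first
          | (rcases h2 with h2 | h2 <;> simp [h2] at h3)
          | (rcases h4 with h4 | h4 <;> simp [h4] at h3))
      (by
        intro x i j a b
        have hX : ∀ i, r * (∑ l, x l * θ (B₁ i 0) l) + s * (∑ l, x l * θ (B₁ i 1) l) = 0 := by
          intro a
          rw [Finset.mul_sum, Finset.mul_sum, ← Finset.sum_add_distrib]
          apply Finset.sum_eq_zero
          intro l _
          linear_combination x l * hrs a l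
        have hm : (∑ l, x l * θ (B₁ i 0) l) * (∑ l, x l * θ (B₁ j 1) l) =
            (∑ l, x l * θ (B₁ i 1) l) * (∑ l, x l * θ (B₁ j 0) l) := by
          have ha := hX i
          have hb := hX j
          by_cases hr : r = 0
          · have hs : s ≠ 0 := fun h => hne ⟨hr, h⟩
            apply mul_left_cancel₀ hs
            linear_combination (∑ l, x l * θ (B₁ i 0) l) * hb - (∑ l, x l * θ (B₁ j 0) l) * ha
          · apply mul_left_cancel₀ hr
            linear_combination (∑ l, x l * θ (B₁ j 1) l) * ha - (∑ l, x l * θ (B₁ i 1) l) * hb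
        fin_cases a <;> fin_cases b
        · rfl
        · exact hm
        · exact hm.symm
        · rfl)
    have := hind' 1 (fun r l => by simp [hz _ r l])
    exact one_ne_zero (congrFun this 0)) hind'
  exact ⟨θ, g00, g01, g10, g11, hdet, fun p =>
    span_normal SB TB θ (fun i => B₁ i 0) (fun i => B₁ i 1) hind g00 g01 g10 g11 f hf p⟩

/-- comparison of wedges in the exterior algebra and as skew matrices -/
theorem ext_iff_wd (v w v' w' : Fin 5 → k) (c : k) :
    ι k v * ι k w = c • (ι k v' * ι k w') ↔ wd v w = c • wd v' w' := by
  classical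
  constructor
  · intro h
    ext i j
    let pr : (Fin 5 → k) →ₗ[k] (Fin 2 → k) := LinearMap.pi ![LinearMap.proj i, LinearMap.proj j]
    let al : (Fin 5 → k) [⋀^Fin 2]→ₗ[k] k := Matrix.detRowAlternating.compLinearMap pr
    let fam : ∀ n, (Fin 5 → k) [⋀^Fin n]→ₗ[k] k := fun n => if h : n = 2 then by subst h; exact al
      else 0
    have hfam : fam 2 = al := by simp [fam]
    have key : ∀ a b : Fin 5 → k, ExteriorAlgebra.liftAlternating fam (ι k a * ι k b) =
        a i * b j - a j * b i := by
      intro a b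
      have e : ι k a * ι k b = ExteriorAlgebra.ιMulti k 2 ![a, b] := by
        simp [ExteriorAlgebra.ιMulti_apply]
      rw [e, ExteriorAlgebra.liftAlternating_apply_ιMulti, hfam]
      simp only [al, AlternatingMap.compLinearMap_apply]
      change Matrix.det (Matrix.of fun i => pr (![a, b] i)) = _
      rw [Matrix.det_fin_two]
      simp [pr, Matrix.of_apply]
    have h' := congrArg (ExteriorAlgebra.liftAlternating fam) h
    rw [map_smul, key, key] at h'
    simpa [wd] using h'
  · intro h
    have ex : ∀ a b : Fin 5 → k, ι k a * ι k b =
        ∑ x : Fin 5 × Fin 5, (a x.1 * b x.2) •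
          (ι k (Pi.single x.1 (1 : k) : Fin 5 → k) * ι k (Pi.single x.2 (1 : k) : Fin 5 → k)) := by
      intro a b
      conv_lhs => rw [pi_eq_sum_univ' a, pi_eq_sum_univ' b]
      rw [map_sum, map_sum, Finset.sum_mul_sum, Fintype.sum_prod_type]
      apply Finset.sum_congr rfl
      intro i _
      apply Finset.sum_congr rfl
      intro j _
      rw [map_smul, map_smul, smul_mul_smul_comm]
    rw [← sub_eq_zero, ex, ex, Finset.smul_sum, ← Finset.sum_sub_distrib]
    refine Finset.sum_involution (fun x _ => (x.2, x.1)) ?_ ?_ ?_ ?_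
    · rintro ⟨i, j⟩ _
      have hs := ExteriorAlgebra.ι_add_mul_swap (R := k) (Pi.single i (1 : k) : Fin 5 → k)
        (Pi.single j (1 : k) : Fin 5 → k)
      have hs' := eq_neg_of_add_eq_zero_right hs
      have hz := congrFun (congrFun h i) j
      simp only [wd, Matrix.of_apply, Matrix.smul_apply, smul_eq_mul] at hz
      simp only [hs']
      have : v i * w j - c * (v' i * w' j) - (v j * w i - c * (v' j * w' i)) = 0 := by
        linear_combination hz
      rw [smul_smul, smul_smul, ← sub_smul, ← sub_smul, smul_neg, ← sub_eq_add_neg, ← sub_smul,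
        this, zero_smul]
    · rintro ⟨i, j⟩ _ hne heq
      apply hne
      simp only [Prod.mk.injEq] at heq
      obtain ⟨h1, -⟩ := heq
      subst h1
      simp [ExteriorAlgebra.ι_sq_zero]
    · intro x _; exact Finset.mem_univ _
    · intro x _; rfl

theorem wd_theta (θ : (Fin 5 → k) ≃ₗ[k] (Fin 5 → k)) (v w v' w' : Fin 5 → k) (c : k) :
    wd (θ v) (θ w) = c • wd (θ v') (θ w') ↔ wd v w = c • wd v' w' := by
  have key : ∀ (θ : (Fin 5 → k) ≃ₗ[k] (Fin 5 → k)) (v w v' w' : Fin 5 → k),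
      wd v w = c • wd v' w' → wd (θ v) (θ w) = c • wd (θ v') (θ w') := by
    intro θ v w v' w' h
    have e : ∀ x, θ x = (LinearMap.toMatrix' θ.toLinearMap).mulVec x := by
      intro x; rw [LinearMap.toMatrix'_mulVec]; rfl
    rw [e, e, e, e, wd_mulVec, wd_mulVec, h]
    simp
  refine ⟨fun h => ?_, key θ _ _ _ _⟩
  have := key θ.symm _ _ _ _ h
  simpa using this

end PartSix

section PartSeven
variable {k : Type*} [Field k]

theorem two_forms (σ τ : (Fin 3 → k) →ₗ[k] k) (x y : Fin 3 → k)
    (hxy : ∀ r s : k, r • x + s • y = 0 → r = 0 ∧ s = 0)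
    (h1 : σ x = 0) (h2 : τ x = 0) (h3 : σ y = 0) (h4 : τ y = 0) (f f' : Fin 3 → k) :
    σ f * τ f' = σ f' * τ f := by
  have hli : ¬ LinearIndependent k ![f, f', x, y] := by
    intro h
    have := h.fintype_card_le_finrank
    simp at this
  rw [Fintype.not_linearIndependent_iff] at hli
  obtain ⟨c, hc, i, hi⟩ := hli
  simp only [Fin.sum_univ_four, Matrix.cons_val] at hc
  have e1 := congrArg σ hc
  have e2 := congrArg τ hc
  simp [h1, h2, h3, h4] at e1 e2
  by_cases h0 : c 0 = 0
  · by_cases h1 : c 1 = 0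
    · exfalso
      rw [h0, h1] at hc
      have := hxy (c 2) (c 3) (by simpa using hc)
      fin_cases i
      · exact hi h0
      · exact hi h1
      · exact hi this.1
      · exact hi this.2
    · apply mul_left_cancel₀ h1
      linear_combination σ f * e2 - τ f * e1
  · apply mul_left_cancel₀ h0
    linear_combination τ f' * e1 - σ f' * e2

/-- pairing of a covector with a matrix-vector product, as a linear form -/
def pairL {n : ℕ} (φ : Fin 5 → k) (S : Matrix (Fin 5) (Fin n) k) : (Fin n → k) →ₗ[k] k where
  toFun f := ∑ i, φ i * S.mulVec f i
  map_add' x y := by simp [Matrix.mulVec_add, mul_add, Finset.sum_add_distrib]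
  map_smul' r x := by
    simp only [Matrix.mulVec_smul, Pi.smul_apply, smul_eq_mul, RingHom.id_apply, Finset.mul_sum]
    apply Finset.sum_congr rfl
    intro i _
    ring

theorem disj_core (A₁ : Matrix (Fin 2) (Fin 4) (Fin 5 → k))
    (B₁ : Matrix (Fin 3) (Fin 2) (Fin 5 → k))
    (hdisj : rankOneLocus A₁ ∩ rankOneLocus B₁ = ∅)
    (g θ : (Fin 5 → k) ≃ₗ[k] (Fin 5 → k)) (hθ : ∀ x v, ∑ l, g x l * v l = ∑ l, x l * θ v l)
    (hg : rankOneLocus A₁ ∪ {0} = g '' coneQuartic k)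
    (S T : Matrix (Fin 5) (Fin 3) k) (h00 h01 h10 h11 : k) (hdet : h00 * h11 - h01 * h10 ≠ 0)
    (hB : ∀ p, p ∈ rowSpace B₁ ↔ ∃ w, θ p.1 = h00 • S.mulVec w + h01 • T.mulVec w ∧
      θ p.2 = h10 • S.mulVec w + h11 • T.mulVec w)
    (hspan : ∀ φ : Fin 5 → k, (∀ w, ∑ i, φ i * S.mulVec w i = 0) →
      (∀ w, ∑ i, φ i * T.mulVec w i = 0) → φ = 0)
    (a b : k) (hab : ¬ (a = 0 ∧ b = 0)) (x y : Fin 3 → k)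
    (hxy : ∀ r s : k, r • x + s • y = 0 → r = 0 ∧ s = 0) (φ : Fin 5 → k)
    (hφ : φ = ![a ^ 4, a ^ 3 * b, a ^ 2 * b ^ 2, a * b ^ 3, b ^ 4])
    (h1 : ∑ i, φ i * S.mulVec x i = 0) (h2 : ∑ i, φ i * T.mulVec x i = 0)
    (h3 : ∑ i, φ i * S.mulVec y i = 0) (h4 : ∑ i, φ i * T.mulVec y i = 0) : False := by
  have hφ0 : φ ≠ 0 := by
    intro h
    apply hab
    rw [h] at hφ
    have e0 := congrFun hφ 0
    have e4 := congrFun hφ 4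
    simp at e0 e4
    exact ⟨pow_eq_zero_iff (by norm_num) |>.1 e0.symm, pow_eq_zero_iff (by norm_num) |>.1 e4.symm⟩
  have hA : g φ ∈ rankOneLocus A₁ := by
    have : g φ ∈ rankOneLocus A₁ ∪ {0} := by rw [hg]; exact ⟨φ, ⟨a, b, hφ⟩, rfl⟩
    rcases this with h | h
    · exact h
    · exact absurd (g.map_eq_zero_iff.1 h) hφ0
  have hlin : ∀ (r s : k) (w : Fin 3 → k), ∑ l, φ l * (r • S.mulVec w + s • T.mulVec w) l =
      r * pairL φ S w + s * pairL φ T w := by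
    intro r s w
    simp only [pairL, LinearMap.coe_mk, AddHom.coe_mk, Finset.mul_sum, ← Finset.sum_add_distrib,
      Pi.add_apply, Pi.smul_apply, smul_eq_mul]
    apply Finset.sum_congr rfl
    intro i _
    ring
  have hrow : ∀ i, ∃ w, θ (B₁ i 0) = h00 • S.mulVec w + h01 • T.mulVec w ∧
      θ (B₁ i 1) = h10 • S.mulVec w + h11 • T.mulVec w := by
    intro i
    exact (hB (B₁ i 0, B₁ i 1)).1 (Submodule.subset_span ⟨i, rfl⟩)
  choose f hf0 hf1 using hrow
  have two := two_forms (pairL φ S) (pairL φ T) x y hxy h1 h2 h3 h4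
  have X0 : ∀ i, ∑ l, g φ l * B₁ i 0 l = h00 * pairL φ S (f i) + h01 * pairL φ T (f i) := by
    intro i; rw [hθ, hf0, hlin]
  have X1 : ∀ i, ∑ l, g φ l * B₁ i 1 l = h10 * pairL φ S (f i) + h11 * pairL φ T (f i) := by
    intro i; rw [hθ, hf1, hlin]
  have hBm : g φ ∈ rankOneLocus B₁ := by
    change Matrix.rank _ = 1
    rw [rank_one_iff]
    constructor
    · intro hz
      have hz' : ∀ i c, ∑ l, g φ l * B₁ i c l = 0 := fun i c => congrFun (congrFun hz i) c
      have hall : ∀ q ∈ rowSpace B₁, ∑ l, g φ l * q.1 l = 0 ∧ ∑ l, g φ l * q.2 l = 0 := by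
        intro q hq
        unfold rowSpace at hq
        induction hq using Submodule.span_induction with
        | mem q hq => obtain ⟨i, rfl⟩ := hq; exact ⟨hz' i 0, hz' i 1⟩
        | zero => simp
        | add q r _ _ hq hr =>
          simp [mul_add, Finset.sum_add_distrib, hq.1, hq.2, hr.1, hr.2]
        | smul c q _ hq =>
          simp only [Prod.smul_fst, Prod.smul_snd, Pi.smul_apply, smul_eq_mul, mul_left_comm _ c,
            ← Finset.mul_sum, hq.1, hq.2, mul_zero, and_self]
      have hk : ∀ w, pairL φ S w = 0 ∧ pairL φ T w = 0 := by
        intro w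
        have hq := hall (θ.symm (h00 • S.mulVec w + h01 • T.mulVec w),
          θ.symm (h10 • S.mulVec w + h11 • T.mulVec w)) ((hB _).2 ⟨w, by simp, by simp⟩)
        simp only [hθ, LinearEquiv.apply_symm_apply, hlin] at hq
        obtain ⟨e0, e1⟩ := hq
        constructor
        · apply mul_left_cancel₀ hdet
          linear_combination h11 * e0 - h01 * e1
        · apply mul_left_cancel₀ hdet
          linear_combination h00 * e1 - h10 * e0
      exact hφ0 (hspan φ (fun w => (hk w).1) (fun w => (hk w).2))
    · intro i j c d
      have t := two (f i) (f j)
      fin_cases c <;> fin_cases d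
      · rfl
      · simp only [Matrix.of_apply, Fin.zero_eta, Fin.mk_one, X0, X1]
        linear_combination (h00 * h11 - h01 * h10) * t
      · simp only [Matrix.of_apply, Fin.zero_eta, Fin.mk_one, X0, X1]
        linear_combination -(h00 * h11 - h01 * h10) * t
      · rfl
  have : g φ ∈ rankOneLocus A₁ ∩ rankOneLocus B₁ := ⟨hA, hBm⟩
  rw [hdisj] at this
  exact this

/-- a linear parametrization of `W`, compatible with the wedge -/
theorem exists_phi [IsAlgClosed k] {n : ℕ} (W : Submodule k ((Fin 5 → k) × (Fin 5 → k)))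
    (θ : (Fin 5 → k) ≃ₗ[k] (Fin 5 → k))
    (S T : Matrix (Fin 5) (Fin n) k) (h00 h01 h10 h11 : k) (hdet : h00 * h11 - h01 * h10 ≠ 0)
    (hB : ∀ p, p ∈ W ↔ ∃ w, θ p.1 = h00 • S.mulVec w + h01 • T.mulVec w ∧
      θ p.2 = h10 • S.mulVec w + h11 • T.mulVec w) :
    ∃ Φ : (Fin n → k) →ₗ[k] (Fin 5 → k) × (Fin 5 → k), (∀ p, p ∈ W ↔ ∃ w, Φ w = p) ∧
      ∀ w, wd (θ (Φ w).1) (θ (Φ w).2) = wd (S.mulVec w) (T.mulVec w) := by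
  obtain ⟨ρ, hρ⟩ := IsAlgClosed.exists_pow_nat_eq (h00 * h11 - h01 * h10)⁻¹ (n := 2) (by norm_num)
  have hρd : ρ ^ 2 * (h00 * h11 - h01 * h10) = 1 := by rw [hρ, inv_mul_cancel₀ hdet]
  have hρ0 : ρ ≠ 0 := by
    rintro rfl
    simp at hρd
  let Φ : (Fin n → k) →ₗ[k] (Fin 5 → k) × (Fin 5 → k) :=
    LinearMap.prod
      (θ.symm.toLinearMap ∘ₗ (ρ • (h00 • S.mulVecLin + h01 • T.mulVecLin)))
      (θ.symm.toLinearMap ∘ₗ (ρ • (h10 • S.mulVecLin + h11 • T.mulVecLin)))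
  have e1 : ∀ w, θ (Φ w).1 = ρ • (h00 • S.mulVec w + h01 • T.mulVec w) := by
    intro w; simp [Φ]
  have e2 : ∀ w, θ (Φ w).2 = ρ • (h10 • S.mulVec w + h11 • T.mulVec w) := by
    intro w; simp [Φ]
  refine ⟨Φ, ?_, ?_⟩
  · intro p
    rw [hB]
    constructor
    · rintro ⟨w, h1, h2⟩
      refine ⟨ρ⁻¹ • w, ?_⟩
      ext1
      · apply θ.injective
        rw [e1, h1, Matrix.mulVec_smul, Matrix.mulVec_smul, smul_comm h00, smul_comm h01,
          ← smul_add, smul_inv_smul₀ hρ0]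
      · apply θ.injective
        rw [e2, h2, Matrix.mulVec_smul, Matrix.mulVec_smul, smul_comm h10, smul_comm h11,
          ← smul_add, smul_inv_smul₀ hρ0]
    · rintro ⟨w, rfl⟩
      refine ⟨ρ • w, ?_, ?_⟩
      · rw [e1, Matrix.mulVec_smul, Matrix.mulVec_smul, smul_comm h00, smul_comm h01, ← smul_add]
      · rw [e2, Matrix.mulVec_smul, Matrix.mulVec_smul, smul_comm h10, smul_comm h11, ← smul_add]
  · intro w
    rw [e1, e2]
    ext i j
    simp only [wd, Matrix.of_apply, Pi.smul_apply, Pi.add_apply, smul_eq_mul]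
    linear_combination (S.mulVec w i * T.mulVec w j - S.mulVec w j * T.mulVec w i) * hρd

/-- everything in normal form -/
theorem setup [IsAlgClosed k]
    (A₁ : Matrix (Fin 2) (Fin 4) (Fin 5 → k)) (B₁ : Matrix (Fin 3) (Fin 2) (Fin 5 → k))
    (hCA : IsRNQuartic A₁) (hSB : IsCubicScroll B₁)
    (hdisj : rankOneLocus A₁ ∩ rankOneLocus B₁ = ∅)
    (hVA : Module.finrank k (colSpace A₁) = 4)
    (hVB : Module.finrank k (rowSpace B₁) = 3) :
    ∃ (S T : Matrix (Fin 5) (Fin 3) k)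
      (H : Matrix (Fin 5) (Fin 5) k →ₗ[k] Matrix (Fin 3) (Fin 3) k)
      (ΦA : (Fin 4 → k) →ₗ[k] (Fin 5 → k) × (Fin 5 → k))
      (ΦB : (Fin 3 → k) →ₗ[k] (Fin 5 → k) × (Fin 5 → k)),
      (∀ f, H (wd (S.mulVec f) (T.mulVec f)) = sqm f) ∧
      (∀ p, p ∈ colSpace A₁ ↔ ∃ w, ΦA w = p) ∧ (∀ p, p ∈ rowSpace B₁ ↔ ∃ w, ΦB w = p) ∧
      (∀ u w (c : k), ι k (ΦA u).1 * ι k (ΦA u).2 = c • (ι k (ΦB w).1 * ι k (ΦB w).2) ↔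
        wd (SA.mulVec u) (TA.mulVec u) = c • wd (S.mulVec w) (T.mulVec w)) ∧
      (∀ u w (c : k), ι k (ΦB u).1 * ι k (ΦB u).2 = c • (ι k (ΦB w).1 * ι k (ΦB w).2) ↔
        wd (S.mulVec u) (T.mulVec u) = c • wd (S.mulVec w) (T.mulVec w)) ∧
      (∀ a b : k, ¬ (a = 0 ∧ b = 0) → ∀ x y : Fin 3 → k,
      (∀ r s : k, r • x + s • y = 0 → r = 0 ∧ s = 0) → ∀ φ : Fin 5 → k,
      φ = ![a ^ 4, a ^ 3 * b, a ^ 2 * b ^ 2, a * b ^ 3, b ^ 4] →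
      ∑ i, φ i * S.mulVec x i = 0 → ∑ i, φ i * T.mulVec x i = 0 →
      ∑ i, φ i * S.mulVec y i = 0 → ∑ i, φ i * T.mulVec y i = 0 → False) := by
  obtain ⟨g, θ, hθ, hg, g00, g01, g10, g11, hgd, hA⟩ := normA_full A₁ hCA hVA
  obtain ⟨θ', h00, h01, h10, h11, hhd, hB⟩ := normB_full B₁ hSB hVB
  let μ : (Fin 5 → k) ≃ₗ[k] (Fin 5 → k) := θ'.symm.trans θ
  let M := LinearMap.toMatrix' μ.toLinearMap
  let N := LinearMap.toMatrix' μ.symm.toLinearMap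
  have hM : ∀ x, M.mulVec x = μ x := by intro x; simp only [M, LinearMap.toMatrix'_mulVec]; rfl
  have hNM : N * M = 1 := by
    simp only [N, M, ← LinearMap.toMatrix'_comp]
    rw [← LinearMap.toMatrix'_id]
    congr 1
    ext1 x
    simp
  let S : Matrix (Fin 5) (Fin 3) k := M * (SB : Matrix (Fin 5) (Fin 3) k)
  let T : Matrix (Fin 5) (Fin 3) k := M * (TB : Matrix (Fin 5) (Fin 3) k)
  have hS : ∀ w, S.mulVec w = μ (SB.mulVec w) := by
    intro w; simp only [S]; rw [← Matrix.mulVec_mulVec, hM]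
  have hT : ∀ w, T.mulVec w = μ (TB.mulVec w) := by
    intro w; simp only [T]; rw [← Matrix.mulVec_mulVec, hM]
  have hB' : ∀ p, p ∈ rowSpace B₁ ↔ ∃ w, θ p.1 = h00 • S.mulVec w + h01 • T.mulVec w ∧
      θ p.2 = h10 • S.mulVec w + h11 • T.mulVec w := by
    intro p
    rw [hB]
    apply exists_congr
    intro w
    rw [hS, hT, ← map_smul, ← map_smul, ← map_smul, ← map_smul, ← map_add, ← map_add]
    have hc : ∀ v x, θ v = μ x ↔ θ' v = x := by
      intro v x
      have : θ v = μ (θ' v) := by simp [μ]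
      rw [this, μ.injective.eq_iff]
    rw [hc, hc]
  obtain ⟨ΦA, rA, wA⟩ := exists_phi (colSpace A₁) θ SA TA g00 g01 g10 g11 hgd hA
  obtain ⟨ΦB, rB, wB⟩ := exists_phi (rowSpace B₁) θ S T h00 h01 h10 h11 hhd hB'
  refine ⟨S, T, hBN N, ΦA, ΦB, hBN_wd M N hNM, rA, rB, ?_, ?_, ?_⟩
  · intro u w c
    rw [ext_iff_wd, ← wd_theta θ, wA, wB]
  · intro u w c
    rw [ext_iff_wd, ← wd_theta θ, wB, wB]
  · refine disj_core A₁ B₁ hdisj g θ hθ hg S T h00 h01 h10 h11 hhd hB' ?_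
    intro φ e1 e2
    have hv : ∀ v : Fin 5 → k, ∑ i, φ i * μ v i = 0 := by
      intro v
      have hd : v = SB.mulVec ![v 0, v 2, v 3] + TB.mulVec ![v 1, 0, v 4] := by
        rw [SB_mulVec, TB_mulVec]
        funext i
        fin_cases i <;> simp
      rw [hd, map_add, ← hS, ← hT]
      simp only [Pi.add_apply, mul_add, Finset.sum_add_distrib, e1, e2, add_zero]
    funext j
    have := hv (μ.symm (Pi.single j 1))
    simpa [Pi.single_apply] using this

end PartSeven

/-!
STATEMENT 15: Assume the generality assumption (`C_A` a smooth rational normal quartic,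
`S_B` a smooth rational cubic scroll, `C_A ∩ S_B = ∅`, `V_A` of dimension 4, `V_B` of
dimension 3), and suppose `Γ = Z_A ∩ Z_B` is finite.  If `Γ` consists of at least 7
distinct points, then four points of `Γ` lie on a common line both in `P(V_A)` and in
`P(V_B)`.

The four points are produced as representatives `p s ∈ V_A`, `q s ∈ V_B` with nonzero
proportional wedges (the same point of `Γ`), pairwise non-proportional (four distinct
points), with the `p s` spanning a subspace of dimension at most 2 (a common line in
`P(V_A)`) and likewise for the `q s`.
-/
theorem stmt15 (k : Type*) [Field k] [IsAlgClosed k]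
    (A₁ : Matrix (Fin 2) (Fin 4) (Fin 5 → k)) (B₁ : Matrix (Fin 3) (Fin 2) (Fin 5 → k))
    (hCA : IsRNQuartic A₁) (hSB : IsCubicScroll B₁)
    (hdisj : rankOneLocus A₁ ∩ rankOneLocus B₁ = ∅)
    (hVA : Module.finrank k (colSpace A₁) = 4)
    (hVB : Module.finrank k (rowSpace B₁) = 3)
    (hfin : (gammaSet A₁ B₁).Finite)
    (hcard : 7 ≤ (gammaSet A₁ B₁).ncard) :
    ∃ p q : Fin 4 → (Fin 5 → k) × (Fin 5 → k),
      (∀ s, p s ∈ colSpace A₁) ∧ (∀ s, q s ∈ rowSpace B₁) ∧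
      (∀ s, ι k (p s).1 * ι k (p s).2 ≠ 0) ∧
      (∀ s, ∃ c : kˣ,
        ι k (q s).1 * ι k (q s).2 = c • (ι k (p s).1 * ι k (p s).2)) ∧
      (∀ s t, s ≠ t → ∀ c : k,
        ι k (p t).1 * ι k (p t).2 ≠ c • (ι k (p s).1 * ι k (p s).2)) ∧
      Module.finrank k (Submodule.span k (Set.range p)) ≤ 2 ∧
      Module.finrank k (Submodule.span k (Set.range q)) ≤ 2 := by
  classical
  obtain ⟨S, T, H, ΦA, ΦB, hH, rA, rB, hAB, hBB, hdis⟩ := setup A₁ B₁ hCA hSB hdisj hVA hVB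
  have hBBs : ∀ u w (c : k), ι k (ΦB u).1 * ι k (ΦB u).2 = c • (ι k (ΦB w).1 * ι k (ΦB w).2) →
      sqm u = c • sqm w := by
    intro u w c h
    have := congrArg H ((hBB u w c).1 h)
    rwa [map_smul, hH, hH] at this
  have hEB : ∀ w, w ≠ 0 → ι k (ΦB w).1 * ι k (ΦB w).2 ≠ 0 := by
    intro w hw h
    apply hw
    have := hBBs w w 0 (by rw [zero_smul]; exact h)
    funext i
    have := congrFun (congrFun this i) i
    simpa [sqm] using this
  have hsc : ∀ (r : k) w, ι k (ΦB (r • w)).1 * ι k (ΦB (r • w)).2 =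
      (r * r) • (ι k (ΦB w).1 * ι k (ΦB w).2) := by
    intro r w
    simp only [map_smul, Prod.smul_fst, Prod.smul_snd, smul_mul_smul_comm]
  have hABe : ∀ u w, wd (SA.mulVec u) (TA.mulVec u) = wd (S.mulVec w) (T.mulVec w) →
      ι k (ΦA u).1 * ι k (ΦA u).2 = ι k (ΦB w).1 * ι k (ΦB w).2 := by
    intro u w h
    have := (hAB u w 1).2 (by rw [one_smul]; exact h)
    rwa [one_smul] at this
  -- seven points
  have hz : ∃ z : Fin 7 → Projectivization k (ExteriorAlgebra k (Fin 5 → k)),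
      Function.Injective z ∧ ∀ i, z i ∈ gammaSet A₁ B₁ := by
    rw [Set.ncard_eq_toFinset_card _ hfin] at hcard
    obtain ⟨t, ht, htc⟩ := Finset.exists_subset_card_eq hcard
    let e := (t.equivFinOfCardEq htc).symm
    refine ⟨fun i => (e i : Projectivization k _), ?_, ?_⟩
    · intro i j h
      exact e.injective (Subtype.ext h)
    · intro i
      exact hfin.mem_toFinset.1 (ht (e i).2)
  obtain ⟨z, hzi, hzm⟩ := hz
  choose ω hω hzω hωAB using hzm
  have hA0 : ∀ i, ∃ u, ω i = ι k (ΦA u).1 * ι k (ΦA u).2 := by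
    intro i
    obtain ⟨p, hp, h⟩ := (hωAB i).1
    obtain ⟨u, rfl⟩ := (rA p).1 hp
    exact ⟨u, h⟩
  have hB0 : ∀ i, ∃ w, ω i = ι k (ΦB w).1 * ι k (ΦB w).2 := by
    intro i
    obtain ⟨p, hp, h⟩ := (hωAB i).2
    obtain ⟨u, rfl⟩ := (rB p).1 hp
    exact ⟨u, h⟩
  choose u hu using hA0
  choose w hw using hB0
  have hzne : ∀ i j, i ≠ j → ∀ c : k, ω j ≠ c • ω i := by
    intro i j hij c h
    apply hij
    apply hzi
    rw [hzω i, hzω j, eq_comm, Projectivization.mk_eq_mk_iff']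
    exact ⟨c, h.symm⟩
  obtain ⟨e, he, hfu, hfw⟩ := core S T H hH u w (by
      intro i
      have := (hAB (u i) (w i) 1).1 (by rw [one_smul, ← hu, ← hw])
      rwa [one_smul] at this) (by
      intro i j hij r s hrs
      by_contra hne
      by_cases hs : s = 0
      · have hr : r ≠ 0 := fun h => hne ⟨h, hs⟩
        have hwi : w i = 0 := by
          rw [hs, zero_smul, add_zero] at hrs
          exact (smul_eq_zero.1 hrs).resolve_left hr
        apply hω i
        rw [hw i, hwi]
        simp
      · have hwj : w j = (-(s⁻¹ * r)) • w i := by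
          have h1 : s • w j = -(r • w i) := eq_neg_of_add_eq_zero_right hrs
          rw [neg_smul, mul_smul, ← smul_neg, ← h1, inv_smul_smul₀ hs]
        apply hzne i j hij ((-(s⁻¹ * r)) * (-(s⁻¹ * r)))
        rw [hw j, hw i, hwj, hsc]) hdis (by
      intro D hD c hc
      let ζ : k → Projectivization k (ExteriorAlgebra k (Fin 5 → k)) := fun t =>
        if h : c t = 0 then z 0 else Projectivization.mk k _ (hEB (c t) h)
      have hmaps : Set.MapsTo ζ D (gammaSet A₁ B₁) := by
        intro t ht
        obtain ⟨h0, f, hf⟩ := hc t ht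
        simp only [ζ, dif_neg h0]
        exact ⟨_, hEB (c t) h0, rfl, ⟨ΦA f, (rA _).2 ⟨f, rfl⟩, (hABe f (c t) hf).symm⟩,
          ⟨ΦB (c t), (rB _).2 ⟨_, rfl⟩, rfl⟩⟩
      obtain ⟨t, ht, t', ht', hne, heq⟩ := hD.exists_ne_map_eq_of_mapsTo hmaps hfin
      refine ⟨t, ht, t', ht', hne, ?_⟩
      simp only [ζ, dif_neg (hc t ht).1, dif_neg (hc t' ht').1] at heq
      rw [Projectivization.mk_eq_mk_iff'] at heq
      obtain ⟨l, hl⟩ := heq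
      have hs := hBBs _ _ _ hl.symm
      obtain ⟨i0, hi0⟩ := Function.ne_iff.1 (hc t ht).1
      refine ⟨c t i0, -(l * c t' i0), fun h => hi0 h.1, ?_⟩
      funext j
      have := congrFun (congrFun hs i0) j
      simp only [sqm, Matrix.of_apply, Matrix.smul_apply, smul_eq_mul] at this
      simp only [Pi.add_apply, Pi.smul_apply, smul_eq_mul, Pi.zero_apply]
      linear_combination this)
  have hfr : ∀ (n : ℕ) (Φ : (Fin n → k) →ₗ[k] (Fin 5 → k) × (Fin 5 → k)) (f : Fin 4 → Fin n → k),
      Module.finrank k (Submodule.span k (Set.range f)) ≤ 2 →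
      Module.finrank k (Submodule.span k (Set.range fun s => Φ (f s))) ≤ 2 := by
    intro n Φ f h
    have hr : (Set.range fun s => Φ (f s)) = Φ '' Set.range f := by
      rw [← Set.range_comp]; rfl
    rw [hr, ← Submodule.map_span]
    exact (Submodule.finrank_map_le _ _).trans h
  refine ⟨fun s => ΦA (u (e s)), fun s => ΦB (w (e s)), fun s => (rA _).2 ⟨_, rfl⟩,
    fun s => (rB _).2 ⟨_, rfl⟩, ?_, ?_, ?_, hfr 4 ΦA _ hfu, hfr 3 ΦB _ hfw⟩
  · intro s
    rw [← hu]; exact hω _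
  · intro s
    refine ⟨1, ?_⟩
    rw [one_smul, ← hu, ← hw]
  · intro s t hst c
    rw [← hu, ← hu]
    exact hzne _ _ (fun h => hst (he h)) c
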